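/- Let Γ be a commutative weakly distance-regular digraph. Then Γ is semicomplete multipartite if and only if Γ is isomorphic to one of the following digraphs: (1) an n-coclique extension of Cay(ℤ₆,{1,2}) with n≥1; (2) an l-coclique extension of a semicomplete weakly distance-regular digraph with girth 2 or 3, with l≥2; (3) an n-coclique extension of Σ∘C₄, where Σ is a semicomplete weakly distance-regular digraph with girth 3 and n≥1; (4) an n-coclique extension of a doubly regular (k,l)-team tournament of Type II with parameters ((k−2)l/4, (k−2)l/4, l²(k−1)/(4(l−1))), where k,l≥2 and n≥1; (5) a doubly regular (k,m)-team semicomplete multipartite digraph of Type II with k,m≥2. -/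

import Mathlib

open Set Matrix

namespace Paper

variable {V : Type*} {W : Type*}

/-- There is a directed walk of length `n` from `x` to `y` in the digraph with arc relation `A`. -/
def HasPathOfLength (A : V → V → Prop) (x y : V) (n : ℕ) : Prop :=
  ∃ p : ℕ → V, p 0 = x ∧ p n = y ∧ ∀ i < n, A (p i) (p (i + 1))

/-- A digraph is strongly connected if there is a directed path between any two vertices. -/
def IsStronglyConnected (A : V → V → Prop) : Prop :=
  ∀ x y, ∃ n, HasPathOfLength A x y n

/-- The distance `∂(x,y)`: the length of a shortest directed path from `x` to `y`. -/
noncomputable def ddist (A : V → V → Prop) (x y : V) : ℕ :=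
  sInf {n | HasPathOfLength A x y n}

/-- The two-way distance `∂̃(x,y) = (∂(x,y), ∂(y,x))`. -/
noncomputable def tdist (A : V → V → Prop) (x y : V) : ℕ × ℕ :=
  (ddist A x y, ddist A y x)

/-- The two-way distance set `∂̃(Γ)`. -/
def tdistSet (A : V → V → Prop) : Set (ℕ × ℕ) :=
  {d | ∃ x y, tdist A x y = d}

/-- The number `p_{ĩ,j̃}(x,y) = |{z : ∂̃(x,z) = ĩ, ∂̃(z,y) = j̃}|`. -/
noncomputable def pnum (A : V → V → Prop) (i j : ℕ × ℕ) (x y : V) : ℕ :=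
  {z | tdist A x z = i ∧ tdist A z y = j}.ncard

/-- A weakly distance-regular digraph. -/
def IsWDRD (A : V → V → Prop) : Prop :=
  IsStronglyConnected A ∧
  (∃ d ∈ tdistSet A, d.1 ≠ d.2) ∧
  ∀ i j : ℕ × ℕ, ∀ x y x' y' : V,
    tdist A x y = tdist A x' y' → pnum A i j x y = pnum A i j x' y'

/-- Commutativity of the attached scheme: `p_{ĩ,j̃}^{h̃} = p_{j̃,ĩ}^{h̃}`. -/
def IsCommutativeDigraph (A : V → V → Prop) : Prop :=
  ∀ i j : ℕ × ℕ, ∀ x y : V, pnum A i j x y = pnum A j i x y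

/-- A commutative weakly distance-regular digraph. -/
def IsCWDRD (A : V → V → Prop) : Prop :=
  IsWDRD A ∧ IsCommutativeDigraph A

/-- `A` is semicomplete multipartite with partition given by `f` (parts are the fibres). -/
def IsSemicompleteMultipartiteWith (A : V → V → Prop) {m : ℕ} (f : V → Fin m) : Prop :=
  (∀ x, ¬ A x x) ∧ (∀ i, 2 ≤ {x | f x = i}.ncard) ∧
  ∀ x y : V, x ≠ y → ((A x y ∨ A y x) ↔ f x ≠ f y)

/-- A semicomplete multipartite digraph: the vertex set is partitioned into `m ≥ 2` partite
sets, each of size at least `2`, and two distinct vertices are joined by an arc in at least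
one direction iff they lie in different partite sets. -/
def IsSemicompleteMultipartite (A : V → V → Prop) : Prop :=
  ∃ m : ℕ, 2 ≤ m ∧ ∃ f : V → Fin m, IsSemicompleteMultipartiteWith A f

/-- A semicomplete digraph: any two distinct vertices are joined by an arc in
at least one direction. -/
def IsSemicomplete (A : V → V → Prop) : Prop :=
  (∀ x, ¬ A x x) ∧ ∀ x y : V, x ≠ y → A x y ∨ A y x

/-- A circuit of length `n`: a sequence `w₀,…,w_{n-1}` with consecutive arcs and an arc
from `w_{n-1}` back to `w₀`. -/
def HasCircuitOfLength (A : V → V → Prop) (n : ℕ) : Prop :=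
  ∃ p : ℕ → V, p n = p 0 ∧ ∀ i < n, A (p i) (p (i + 1))

/-- The girth: the length of a shortest circuit. -/
noncomputable def girth (A : V → V → Prop) : ℕ :=
  sInf {n | 1 ≤ n ∧ HasCircuitOfLength A n}

/-- Lexicographic product of digraphs. -/
def lexProd (A : V → V → Prop) (B : W → W → Prop) : V × W → V × W → Prop :=
  fun u v => A u.1 v.1 ∨ (u.1 = v.1 ∧ B u.2 v.2)

/-- The `n`-coclique extension of a digraph: `A ∘ K̄ₙ`. -/
def cocliqueExt (A : V → V → Prop) (n : ℕ) : V × Fin n → V × Fin n → Prop :=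
  lexProd A (fun _ _ : Fin n => False)

/-- Isomorphism of digraphs. -/
def Iso (A : V → V → Prop) (B : W → W → Prop) : Prop :=
  ∃ e : V ≃ W, ∀ x y : V, A x y ↔ B (e x) (e y)

/-- An `(m,r)`-team semicomplete multipartite digraph with partite sets the fibres of `f`:
`m ≥ 2` parts, each of size `r ≥ 2`. -/
def IsTeamSMD (A : V → V → Prop) {m : ℕ} (f : V → Fin m) (r : ℕ) : Prop :=
  2 ≤ m ∧ 2 ≤ r ∧ (∀ x, ¬ A x x) ∧ (∀ i : Fin m, {x | f x = i}.ncard = r) ∧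
  ∀ x y : V, x ≠ y → ((A x y ∨ A y x) ↔ f x ≠ f y)

/-- Regular of valency `k`: every vertex has exactly `k` out-neighbours and `k`
in-neighbours. -/
def IsRegularOfValency (A : V → V → Prop) (k : ℕ) : Prop :=
  ∀ x : V, {y | A x y}.ncard = k ∧ {y | A y x}.ncard = k

open Classical in
/-- Adjacency matrix of the symmetric part `EΓ`. -/
noncomputable def matE (A : V → V → Prop) : Matrix V V ℤ :=
  Matrix.of fun x y => if A x y ∧ A y x then 1 else 0

open Classical in
/-- Adjacency matrix of the asymmetric part `A⃗Γ`. -/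
noncomputable def matAr (A : V → V → Prop) : Matrix V V ℤ :=
  Matrix.of fun x y => if A x y ∧ ¬ A y x then 1 else 0

open Classical in
/-- Adjacency matrix of a digraph. -/
noncomputable def matAdj (A : V → V → Prop) : Matrix V V ℤ :=
  Matrix.of fun x y => if A x y then 1 else 0

/-- The all-ones matrix `J`. -/
def matJ (V : Type*) : Matrix V V ℤ := Matrix.of fun _ _ => 1

open Classical in
/-- The matrix equations in the definition of a doubly regular team semicomplete multipartite
digraph, with constants `t, αᵢ, βᵢ, γᵢ, ηᵢ` (`A₀ = matE A`, `A₁ = matAr A`). -/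
def DRConstEq [Fintype V] (A : V → V → Prop) (t : ℤ) (α β γ η : ℕ → ℤ) : Prop :=
  ∀ i j : Fin 2,
    ![matE A, matAr A] i * ![matE A, matAr A] j =
      (if (i : ℕ) + (j : ℕ) = 0 then t else 0) • (1 : Matrix V V ℤ) +
      α ((i : ℕ) + (j : ℕ)) • matAr A +
      β ((i : ℕ) + (j : ℕ)) • (matAr A)ᵀ +
      γ ((i : ℕ) + (j : ℕ)) • matE A +
      η ((i : ℕ) + (j : ℕ)) • (matJ V - 1 - matAr A - (matAr A)ᵀ - matE A)

/-- A doubly regular `(m,r)`-team semicomplete multipartite digraph. -/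
def IsDoublyRegularTeamSMD [Fintype V] (A : V → V → Prop) {m : ℕ} (f : V → Fin m)
    (r : ℕ) : Prop :=
  IsTeamSMD A f r ∧ (∃ k, IsRegularOfValency A k) ∧
  ∃ t α β γ η, DRConstEq A t α β γ η

/-- `A_j⁺(x)`: out-neighbours of `x` in the part `j` via single arcs. -/
def Aplus (A : V → V → Prop) {m : ℕ} (f : V → Fin m) (j : Fin m) (x : V) : Set V :=
  {y | f y = j ∧ A x y ∧ ¬ A y x}

/-- `E_j(x)`: neighbours of `x` in the part `j` via edges (pairs of opposite arcs). -/
def Epart (A : V → V → Prop) {m : ℕ} (f : V → Fin m) (j : Fin m) (x : V) : Set V :=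
  {y | f y = j ∧ A x y ∧ A y x}

/-- Type I: `β₁+β₂-α₁-α₂ = r` and the digraph is an `r`-coclique extension of a
semicomplete digraph. -/
def TypeI (A : V → V → Prop) (r : ℕ) (α β : ℕ → ℤ) : Prop :=
  β 1 + β 2 - α 1 - α 2 = (r : ℤ) ∧
  ∃ (N : ℕ) (S : Fin N → Fin N → Prop),
    1 ≤ N ∧ IsSemicomplete S ∧ Iso A (cocliqueExt S r)

/-- Type II: `β₁+β₂-α₁-α₂ = 0` and `c_{ij} = c_{ji} = (r - e_{ij})/2` for all pairs `i ≠ j`. -/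
def TypeII (A : V → V → Prop) {m : ℕ} (f : V → Fin m) (r : ℕ) (α β : ℕ → ℤ) : Prop :=
  β 1 + β 2 - α 1 - α 2 = 0 ∧
  ∀ i j : Fin m, i ≠ j → ∃ c e : ℕ,
    (∀ x, f x = i → (Aplus A f j x).ncard = c ∧ (Epart A f j x).ncard = e) ∧
    (∀ y, f y = j → (Aplus A f i y).ncard = c) ∧
    c + c + e = r

/-- Condition (ii) of Type III for the ordered pair `(i,j)`: `V_i` splits as
`V_i' ∪ V_i''` with `(V_i' × V_j) ∪ (V_j × V_i'') ⊆ A⃗Γ`. -/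
def TypeIIIsplitB (A : V → V → Prop) {m : ℕ} (f : V → Fin m) (i j : Fin m) : Prop :=
  ∃ S : Set V, S ⊆ {x | f x = i} ∧ S.Nonempty ∧ ({x | f x = i} \ S).Nonempty ∧
    (∀ x ∈ S, ∀ y : V, f y = j → A x y ∧ ¬ A y x) ∧
    (∀ y : V, f y = j → ∀ x ∈ {x | f x = i} \ S, A y x ∧ ¬ A x y)

/-- Condition (iii) of Type III for the pair `(i,j)`. -/
def TypeIIIsplitC (A : V → V → Prop) {m : ℕ} (f : V → Fin m) (i j : Fin m) : Prop :=
  ∃ S T' : Set V,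
    S ⊆ {x | f x = i} ∧ S.Nonempty ∧ ({x | f x = i} \ S).Nonempty ∧
    T' ⊆ {y | f y = j} ∧ T'.Nonempty ∧ ({y | f y = j} \ T').Nonempty ∧
    (∀ x ∈ S, ∀ y ∈ T', A x y ∧ A y x) ∧
    (∀ x ∈ {x | f x = i} \ S, ∀ y ∈ {y | f y = j} \ T', A x y ∧ A y x) ∧
    (∀ x ∈ S, ∀ y ∈ {y | f y = j} \ T', A x y ∧ ¬ A y x) ∧
    (∀ y ∈ T', ∀ x ∈ {x | f x = i} \ S, A y x ∧ ¬ A x y)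

/-- Type III. -/
def TypeIII (A : V → V → Prop) {m : ℕ} (f : V → Fin m) (r : ℕ) (α β : ℕ → ℤ) : Prop :=
  2 * (β 1 + β 2 - α 1 - α 2) = (r : ℤ) ∧
  ∀ i j : Fin m, i ≠ j →
    (∀ x y : V, f x = i → f y = j → A x y ∧ A y x) ∨
    (TypeIIIsplitB A f i j ∨ TypeIIIsplitB A f j i) ∨
    TypeIIIsplitC A f i j

/-- An `(m,r)`-team tournament: an `(m,r)`-team semicomplete multipartite digraph with
no pair of opposite arcs. -/
def IsTeamTournament (A : V → V → Prop) {m : ℕ} (f : V → Fin m) (r : ℕ) : Prop :=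
  IsTeamSMD A f r ∧ ∀ x y : V, ¬ (A x y ∧ A y x)

open Classical in
/-- A doubly regular `(m,r)`-team tournament with parameters `(α,β,γ)`:
`A² = αA + βAᵀ + γ(J - I - A - Aᵀ)`. -/
def IsDRTeamTournament [Fintype V] (A : V → V → Prop) {m : ℕ} (f : V → Fin m) (r : ℕ)
    (α β γ : ℤ) : Prop :=
  IsTeamTournament A f r ∧ (∃ k, IsRegularOfValency A k) ∧
  matAdj A * matAdj A =
    α • matAdj A + β • (matAdj A)ᵀ + γ • (matJ V - 1 - matAdj A - (matAdj A)ᵀ)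

/-- Type II of a doubly regular team tournament: `β - α = 0`, `r` even, and
`|N⁺(x) ∩ V_i| = r/2` for every partite set `V_i` and vertex `x ∉ V_i`. -/
def TournamentTypeII (A : V → V → Prop) {m : ℕ} (f : V → Fin m) (r : ℕ) (α β : ℤ) : Prop :=
  β = α ∧ Even r ∧ ∀ (i : Fin m) (x : V), f x ≠ i → 2 * {y | f y = i ∧ A x y}.ncard = r

/-- The Cayley digraph `Cay(ℤ₆, {1,2})`. -/
def Cay6 : ZMod 6 → ZMod 6 → Prop := fun x y => y - x = 1 ∨ y - x = 2

/-- The directed cycle `C₄`. -/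
def C4 : ZMod 4 → ZMod 4 → Prop := fun x y => y = x + 1

/-! ### Counting in coloured pairs -/

/-- The number of `z` with `c x z = i` and `c z y = j`. -/
noncomputable def cnum {κ : Type*} (c : V → V → κ) (i j : κ) (x y : V) : ℕ :=
  {z | c x z = i ∧ c z y = j}.ncard

/-- The number of `z` such that the colour of `(x,z)` satisfies `K` and that of `(z,y)`
satisfies `L`. -/
noncomputable def cset {κ : Type*} (c : V → V → κ) (K L : κ → Prop) (x y : V) : ℕ :=
  {z | K (c x z) ∧ L (c z y)}.ncard

/-- A commutative association scheme whose relations are the colour classes of `c`, with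
colours in `ℕ × ℕ` such that transposition of relations swaps the coordinates. -/
structure IsCScheme (c : V → V → ℕ × ℕ) : Prop where
  diag : ∀ x y, c x y = (0, 0) ↔ x = y
  swap : ∀ x y, c y x = (c x y).swap
  reg : ∀ i j x y x' y', c x y = c x' y' → cnum c i j x y = cnum c i j x' y'
  comm : ∀ i j x y, cnum c i j x y = cnum c j i x y

open Classical in
theorem cset_eq_sum {κ : Type*} [Fintype V] (c : V → V → κ) (K L : κ → Prop) (x y : V) :
    cset c K L x y =
      ∑ p ∈ (((Finset.univ : Finset (V × V)).image fun q => c q.1 q.2) ×ˢ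
        ((Finset.univ : Finset (V × V)).image fun q => c q.1 q.2)).filter
          (fun p => K p.1 ∧ L p.2), cnum c p.1 p.2 x y := by
  unfold cset cnum
  simp only [Set.ncard_eq_toFinset_card', Set.toFinset_ofPred]
  rw [Finset.card_eq_sum_card_fiberwise (f := fun z => (c x z, c z y))
    (t := (((Finset.univ : Finset (V × V)).image fun q => c q.1 q.2) ×ˢ
        ((Finset.univ : Finset (V × V)).image fun q => c q.1 q.2)).filter
          (fun p => K p.1 ∧ L p.2))]
  · refine Finset.sum_congr rfl fun p hp => ?_
    rw [Finset.mem_filter] at hp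
    congr 1
    ext z
    simp only [Finset.mem_filter, Finset.mem_univ, true_and, Prod.ext_iff]
    constructor
    · rintro ⟨_, h⟩; exact h
    · rintro ⟨h1, h2⟩
      refine ⟨?_, h1, h2⟩
      rw [h1, h2]; exact hp.2
  · intro z hz
    simp only [Finset.coe_filter, Finset.mem_univ, true_and, Set.mem_ofPred_eq] at hz
    simp only [Finset.coe_filter, Set.mem_ofPred_eq, Finset.mem_product, Finset.mem_image,
      Finset.mem_univ, true_and]
    exact ⟨⟨⟨(x, z), rfl⟩, ⟨(z, y), rfl⟩⟩, hz⟩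

theorem IsCScheme.cset_reg [Fintype V] {c : V → V → ℕ × ℕ} (h : IsCScheme c)
    (K L : ℕ × ℕ → Prop) {x y x' y' : V} (e : c x y = c x' y') :
    cset c K L x y = cset c K L x' y' := by
  rw [cset_eq_sum, cset_eq_sum]
  exact Finset.sum_congr rfl fun p _ => h.reg _ _ _ _ _ _ e

theorem IsCScheme.cset_comm [Fintype V] {c : V → V → ℕ × ℕ} (h : IsCScheme c)
    (K L : ℕ × ℕ → Prop) (x y : V) :
    cset c K L x y = cset c L K x y := by
  rw [cset_eq_sum, cset_eq_sum]
  refine Finset.sum_nbij' Prod.swap Prod.swap ?_ ?_ ?_ ?_ ?_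
  · simp only [Finset.mem_filter, Finset.mem_product, Prod.fst_swap, Prod.snd_swap]; tauto
  · simp only [Finset.mem_filter, Finset.mem_product, Prod.fst_swap, Prod.snd_swap]; tauto
  · simp
  · simp
  · intro p _; exact h.comm _ _ _ _

theorem IsCScheme.cset_swap {c : V → V → ℕ × ℕ} (h : IsCScheme c)
    (K L : ℕ × ℕ → Prop) (x y : V) :
    cset c K L x y = cset c (fun i => L i.swap) (fun i => K i.swap) y x := by
  unfold cset
  congr 1
  ext z
  simp only [Set.mem_ofPred_eq, ← h.swap]
  tauto

/-- The number of `z` such that the colour of `(x,z)` satisfies `K`. -/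
noncomputable def cval {κ : Type*} (c : V → V → κ) (K : κ → Prop) (x : V) : ℕ :=
  {z | K (c x z)}.ncard

theorem IsCScheme.cval_reg [Fintype V] {c : V → V → ℕ × ℕ} (h : IsCScheme c)
    (K : ℕ × ℕ → Prop) (x y : V) : cval c K x = cval c K y := by
  have := h.cset_reg K (fun _ => True) (x := x) (y := x) (x' := y) (y' := y)
    (by rw [(h.diag x x).2 rfl, (h.diag y y).2 rfl])
  simpa [cset, cval] using this

theorem IsCScheme.cval_swap [Fintype V] {c : V → V → ℕ × ℕ} (h : IsCScheme c)
    (K : ℕ × ℕ → Prop) (x : V) : cval c (fun i => K i.swap) x = cval c K x := by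
  have := h.cset_comm K (fun _ => True) x x
  rw [h.cset_swap (fun _ => True)] at this
  have h2 := h.cset_swap K (fun _ => True) x x
  have h3 := h.cset_comm (fun _ => True) (fun i => K i.swap) x x
  simp only [cset, cval, true_and, and_true] at *
  rw [h2, h3]

theorem ncard_congr_set {p q : V → Prop} (h : ∀ z, p z ↔ q z) :
    {z | p z}.ncard = {z | q z}.ncard := by
  congr 1; ext z; exact h z

theorem ncard_split [Finite V] (p q : V → Prop) :
    {z | p z}.ncard = {z | p z ∧ q z}.ncard + {z | p z ∧ ¬ q z}.ncard := by
  rw [← Set.ncard_union_eq]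
  · congr 1; ext z; simp only [Set.mem_ofPred_eq, Set.mem_union]; tauto
  · rw [Set.disjoint_left]; intro z hz hz'; exact hz'.2 hz.2

theorem ncard_mono_set [Finite V] {p q : V → Prop} (h : ∀ z, p z → q z) :
    {z | p z}.ncard ≤ {z | q z}.ncard :=
  Set.ncard_le_ncard (fun z hz => h z hz) (Set.toFinite _)

theorem of_ncard_le [Finite V] {p q : V → Prop} (h : ∀ z, p z → q z)
    (hc : {z | q z}.ncard ≤ {z | p z}.ncard) (z : V) (hz : q z) : p z := by
  have : {z | p z} = {z | q z} :=
    Set.eq_of_subset_of_ncard_le (fun z hz => h z hz) hc (Set.toFinite _)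
  have h2 : z ∈ {z | p z} := by rw [this]; exact hz
  exact h2

theorem ncard_pos_iff [Finite V] {p : V → Prop} : 0 < {z | p z}.ncard ↔ ∃ z, p z := by
  rw [Set.ncard_pos]; rfl

theorem ncard_zero_iff [Finite V] {p : V → Prop} : {z | p z}.ncard = 0 ↔ ∀ z, ¬ p z := by
  rw [Set.ncard_eq_zero, Set.eq_empty_iff_forall_notMem]; rfl

/-- Double counting of the pairs in a relation. -/
theorem double_count [Fintype V] {p q : V → Prop} {R : V → V → Prop} {m n : ℕ}
    (hm : ∀ a, p a → {b | q b ∧ R a b}.ncard = m) (hn : ∀ b, q b → {a | p a ∧ R a b}.ncard = n) :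
    {a | p a}.ncard * m = {b | q b}.ncard * n := by
  classical
  simp only [Set.ncard_eq_toFinset_card', Set.toFinset_ofPred] at *
  refine Finset.card_mul_eq_card_mul R (fun a ha => ?_) (fun b hb => ?_)
  · rw [← hm a (by simpa using ha), Finset.bipartiteAbove, Finset.filter_filter]
  · rw [← hn b (by simpa using hb), Finset.bipartiteBelow, Finset.filter_filter]

theorem sum_count_comm [Fintype V] {p q : V → Prop} {R : V → V → Prop} :
    ∑ a ∈ {a | p a}.toFinite.toFinset, {b | q b ∧ R a b}.ncard =
      ∑ b ∈ {b | q b}.toFinite.toFinset, {a | p a ∧ R a b}.ncard := by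
  classical
  have := Finset.sum_card_bipartiteAbove_eq_sum_card_bipartiteBelow
    (s := {a | p a}.toFinite.toFinset) (t := {b | q b}.toFinite.toFinset) R
  simp only [Set.ncard_eq_toFinset_card', Set.toFinset_ofPred]
  convert this using 3
  · simp [Finset.bipartiteAbove]; ext; simp
  · simp [Finset.bipartiteBelow]; ext; simp

/-- A relation that is an equivalence has a labelling of its classes. -/
theorem exists_labelling [Finite V] (r : V → V → Prop) (hr : Equivalence r) :
    ∃ (N : ℕ) (π : V → Fin N), Function.Surjective π ∧ ∀ x y, π x = π y ↔ r x y := by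
  classical
  let s : Setoid V := ⟨r, hr⟩
  obtain ⟨N, ⟨e⟩⟩ := Finite.exists_equiv_fin (Quotient s)
  refine ⟨N, fun x => e (Quotient.mk s x), ?_, ?_⟩
  · exact e.surjective.comp Quotient.mk_surjective
  · intro x y
    rw [e.apply_eq_iff_eq, Quotient.eq]; rfl

/-- If all fibres of a map have the same size, the domain is a product. -/
theorem exists_fibre_equiv [Finite V] {N n : ℕ} (π : V → Fin N)
    (hn : ∀ s, {x | π x = s}.ncard = n) :
    ∃ e : V ≃ Fin N × Fin n, ∀ x, (e x).1 = π x := by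
  classical
  have h : ∀ s, Nonempty ({x // π x = s} ≃ Fin n) := fun s =>
    ⟨Finite.equivFinOfCardEq (by rw [← hn s]; rfl)⟩
  let e1 : V ≃ Σ s, {x // π x = s} := (Equiv.sigmaFiberEquiv π).symm
  let e2 : (Σ s, {x // π x = s}) ≃ Σ _ : Fin N, Fin n := Equiv.sigmaCongrRight fun s => (h s).some
  refine ⟨(e1.trans e2).trans (Equiv.sigmaEquivProd _ _), fun x => rfl⟩

/-! ### Distances -/

theorem hasPath_zero {A : V → V → Prop} {x y : V} : HasPathOfLength A x y 0 ↔ x = y := by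
  constructor
  · rintro ⟨p, h0, h1, _⟩; exact h0.symm.trans h1
  · rintro rfl; exact ⟨fun _ => x, rfl, rfl, fun i hi => absurd hi (Nat.not_lt_zero i)⟩

theorem hasPath_succ {A : V → V → Prop} {x y : V} {n : ℕ} :
    HasPathOfLength A x y (n + 1) ↔ ∃ z, A x z ∧ HasPathOfLength A z y n := by
  constructor
  · rintro ⟨p, h0, h1, h2⟩
    refine ⟨p 1, ?_, fun i => p (i + 1), rfl, h1, fun i hi => h2 (i + 1) (by omega)⟩
    have := h2 0 (by omega)
    rwa [h0] at this
  · rintro ⟨z, hz, p, h0, h1, h2⟩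
    refine ⟨fun i => if i = 0 then x else p (i - 1), rfl, by simpa using h1, fun i hi => ?_⟩
    rcases i with _ | i
    · simpa [h0] using hz
    · simpa using h2 i (by omega)

theorem hasPath_succ' {A : V → V → Prop} {x y : V} {n : ℕ} :
    HasPathOfLength A x y (n + 1) ↔ ∃ z, HasPathOfLength A x z n ∧ A z y := by
  constructor
  · rintro ⟨p, h0, h1, h2⟩
    exact ⟨p n, ⟨p, h0, rfl, fun i hi => h2 i (by omega)⟩, h1 ▸ h2 n (by omega)⟩
  · rintro ⟨z, ⟨p, h0, h1, h2⟩, hz⟩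
    refine ⟨fun i => if i ≤ n then p i else y, by simpa using h0, by simp, fun i hi => ?_⟩
    rcases Nat.lt_or_ge i n with h | h
    · have h3 : i + 1 ≤ n := h
      simpa [h.le, h3] using h2 i h
    · obtain rfl : i = n := by omega
      simpa [h1] using hz

theorem hasPath_one {A : V → V → Prop} {x y : V} : HasPathOfLength A x y 1 ↔ A x y := by
  rw [hasPath_succ]; simp [hasPath_zero]

theorem hasPath_two {A : V → V → Prop} {x y : V} :
    HasPathOfLength A x y 2 ↔ ∃ z, A x z ∧ A z y := by
  rw [hasPath_succ]; simp [hasPath_one]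

theorem ddist_le {A : V → V → Prop} {x y : V} {n : ℕ} (h : HasPathOfLength A x y n) :
    ddist A x y ≤ n := Nat.sInf_le h

theorem ddist_spec {A : V → V → Prop} (hc : IsStronglyConnected A) (x y : V) :
    HasPathOfLength A x y (ddist A x y) := Nat.sInf_mem (hc x y)

theorem ddist_eq_zero {A : V → V → Prop} (hc : IsStronglyConnected A) {x y : V} :
    ddist A x y = 0 ↔ x = y := by
  constructor
  · intro h
    have := ddist_spec hc x y
    rwa [h, hasPath_zero] at this
  · intro h
    exact Nat.le_zero.1 (ddist_le (hasPath_zero.2 h))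

theorem ddist_eq_one {A : V → V → Prop} (hirr : ∀ x, ¬ A x x) (hc : IsStronglyConnected A)
    {x y : V} : ddist A x y = 1 ↔ A x y := by
  constructor
  · intro h
    have := ddist_spec hc x y
    rwa [h, hasPath_one] at this
  · intro h
    have h1 := ddist_le (hasPath_one.2 h)
    have h2 : ddist A x y ≠ 0 := fun h0 => by
      rw [ddist_eq_zero hc] at h0; subst h0; exact hirr _ h
    omega

theorem ddist_eq_two {A : V → V → Prop} (hirr : ∀ x, ¬ A x x) (hc : IsStronglyConnected A)
    {x y : V} : ddist A x y = 2 ↔ x ≠ y ∧ ¬ A x y ∧ ∃ z, A x z ∧ A z y := by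
  constructor
  · intro h
    have := ddist_spec hc x y
    rw [h, hasPath_two] at this
    refine ⟨fun e => ?_, fun e => ?_, this⟩
    · rw [(ddist_eq_zero hc).2 e] at h; omega
    · rw [(ddist_eq_one hirr hc).2 e] at h; omega
  · rintro ⟨h0, h1, h2⟩
    have h3 := ddist_le (hasPath_two.2 h2)
    have h4 := mt (ddist_eq_zero hc).1 h0
    have h5 := mt (ddist_eq_one hirr hc).1 h1
    omega

theorem IsCWDRD.isCScheme {A : V → V → Prop} (h : IsCWDRD A) : IsCScheme (tdist A) where
  diag x y := by
    have hc := h.1.1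
    simp only [tdist, Prod.mk.injEq, ddist_eq_zero hc]
    exact ⟨fun e => e.1, fun e => ⟨e, e.symm⟩⟩
  swap x y := rfl
  reg i j x y x' y' e := h.1.2.2 i j x y x' y' e
  comm i j x y := h.2 i j x y

theorem IsCScheme.isCWDRD {A : V → V → Prop} (h : IsCScheme (tdist A))
    (hc : IsStronglyConnected A) (ha : ∃ d ∈ tdistSet A, d.1 ≠ d.2) : IsCWDRD A :=
  ⟨⟨hc, ha, fun i j x y x' y' e => h.reg i j x y x' y' e⟩, fun i j x y => h.comm i j x y⟩

/-! ### Quotients of schemes -/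

theorem ncard_fibres [Fintype V] {N n : ℕ} {π : V → Fin N}
    (hn : ∀ s, {x | π x = s}.ncard = n) (q : Fin N → Prop) :
    {x | q (π x)}.ncard = n * {s | q s}.ncard := by
  classical
  simp only [Set.ncard_eq_toFinset_card', Set.toFinset_ofPred] at *
  rw [Finset.card_eq_sum_card_fiberwise (f := π) (t := Finset.univ.filter q)]
  · rw [Finset.sum_congr rfl (g := fun _ => n), Finset.sum_const, smul_eq_mul, mul_comm]
    intro s hs
    rw [← hn s, Finset.filter_filter]
    congr 1; ext x
    simp only [Finset.mem_filter, Finset.mem_univ, true_and] at hs ⊢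
    constructor
    · exact fun h => h.2
    · intro h; exact ⟨h ▸ hs, h⟩
  · intro x hx
    simpa using hx

/-- A scheme whose colours are constant on pairs of distinct fibres of `π` induces a scheme on
the set of fibres. -/
theorem IsCScheme.quotient [Fintype V] {c : V → V → ℕ × ℕ} (h : IsCScheme c) {N n : ℕ}
    {π : V → Fin N} {σ : Fin N → V} (hσ : ∀ s, π (σ s) = s) (hn0 : 0 < n)
    (hn : ∀ s, {x | π x = s}.ncard = n)
    (hK : ∀ x y x' y', c x y = c x' y' → π x = π y → π x' = π y')
    (hcol : ∀ x y, π x ≠ π y → c x y = c (σ (π x)) (σ (π y))) :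
    IsCScheme (fun s t => c (σ s) (σ t)) := by
  have hinj : ∀ s t, σ s = σ t → s = t := fun s t e => by rw [← hσ s, ← hσ t, e]
  have hdiag : ∀ s t, c (σ s) (σ t) = (0, 0) ↔ s = t := fun s t => by
    rw [h.diag]; exact ⟨hinj s t, fun e => by rw [e]⟩
  have hcol0 : ∀ s t x y, c (σ s) (σ t) = c x y → π x = π y → s = t := by
    intro s t x y e e'
    have := hK _ _ _ _ e.symm e'
    rwa [hσ, hσ] at this
  have main : ∀ i j s t, i ≠ (0, 0) → j ≠ (0, 0) → (∃ s t, c (σ s) (σ t) = i) →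
      (∃ s t, c (σ s) (σ t) = j) →
      cnum c i j (σ s) (σ t) = n * cnum (fun s t => c (σ s) (σ t)) i j s t := by
    rintro i j s t hi hj ⟨s1, t1, rfl⟩ ⟨s2, t2, rfl⟩
    have hi' : s1 ≠ t1 := fun e => hi ((hdiag _ _).2 e)
    have hj' : s2 ≠ t2 := fun e => hj ((hdiag _ _).2 e)
    unfold cnum
    rw [← ncard_fibres hn
      (fun u => c (σ s) (σ u) = c (σ s1) (σ t1) ∧ c (σ u) (σ t) = c (σ s2) (σ t2))]
    congr 1
    ext z
    simp only [Set.mem_ofPred_eq]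
    constructor
    · rintro ⟨h1, h2⟩
      have e1 : π (σ s) ≠ π z := fun e => hi' (hcol0 _ _ _ _ h1.symm e)
      have e2 : π z ≠ π (σ t) := fun e => hj' (hcol0 _ _ _ _ h2.symm e)
      have e3 := hcol _ _ e1
      have e4 := hcol _ _ e2
      rw [hσ] at e3 e4
      rw [← e3, ← e4]; exact ⟨h1, h2⟩
    · rintro ⟨h1, h2⟩
      have e1 : π (σ s) ≠ π z := fun e => by
        rw [hσ] at e; subst e
        exact hi (by rw [← h1]; exact (h.diag _ _).2 rfl)
      have e2 : π z ≠ π (σ t) := fun e => by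
        rw [hσ] at e; rw [e] at h2
        exact hj (by rw [← h2]; exact (h.diag _ _).2 rfl)
      have e3 := hcol _ _ e1
      have e4 := hcol _ _ e2
      rw [hσ] at e3 e4
      rw [e3, e4]; exact ⟨h1, h2⟩
  have left0 : ∀ j s t, cnum (fun s t => c (σ s) (σ t)) (0, 0) j s t =
      {u : Fin N | u = s ∧ c (σ s) (σ t) = j}.ncard := by
    intro j s t
    unfold cnum
    congr 1; ext u
    simp only [Set.mem_ofPred_eq, hdiag]
    constructor
    · rintro ⟨rfl, h2⟩; exact ⟨rfl, h2⟩
    · rintro ⟨rfl, h2⟩; exact ⟨rfl, h2⟩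
  have right0 : ∀ j s t, cnum (fun s t => c (σ s) (σ t)) j (0, 0) s t =
      {u : Fin N | u = t ∧ c (σ s) (σ t) = j}.ncard := by
    intro j s t
    unfold cnum
    congr 1; ext u
    simp only [Set.mem_ofPred_eq, hdiag]
    constructor
    · rintro ⟨h2, rfl⟩; exact ⟨rfl, h2⟩
    · rintro ⟨rfl, h2⟩; exact ⟨h2, rfl⟩
  have card0 : ∀ (s : Fin N) (p : Prop), {u : Fin N | u = s ∧ p}.ncard =
      {u : Unit | p}.ncard := by
    intro s p
    by_cases hp : p
    · simp [hp]
    · simp [hp]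
  have zero : ∀ i j s t, (¬ (∃ s t, c (σ s) (σ t) = i) ∨ ¬ (∃ s t, c (σ s) (σ t) = j)) →
      cnum (fun s t => c (σ s) (σ t)) i j s t = 0 := by
    intro i j s t hij
    unfold cnum
    rw [ncard_zero_iff]
    rintro u ⟨h1, h2⟩
    rcases hij with h3 | h3
    · exact h3 ⟨_, _, h1⟩
    · exact h3 ⟨_, _, h2⟩
  refine ⟨hdiag, fun s t => h.swap _ _, ?_, ?_⟩
  · intro i j s t s' t' e
    by_cases hi : i = (0, 0)
    · subst hi; rw [left0, left0, card0, card0, e]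
    by_cases hj : j = (0, 0)
    · subst hj; rw [right0, right0, card0, card0, e]
    by_cases hij : (∃ s t, c (σ s) (σ t) = i) ∧ (∃ s t, c (σ s) (σ t) = j)
    · refine Nat.eq_of_mul_eq_mul_left hn0 ?_
      rw [← main i j s t hi hj hij.1 hij.2, ← main i j s' t' hi hj hij.1 hij.2]
      exact h.reg _ _ _ _ _ _ e
    · have := not_and_or.1 hij
      rw [zero i j s t this, zero i j s' t' this]
  · intro i j s t
    by_cases hi : i = (0, 0)
    · subst hi; rw [left0, right0, card0, card0]
    by_cases hj : j = (0, 0)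
    · subst hj; rw [left0, right0, card0, card0]
    by_cases hij : (∃ s t, c (σ s) (σ t) = i) ∧ (∃ s t, c (σ s) (σ t) = j)
    · refine Nat.eq_of_mul_eq_mul_left hn0 ?_
      rw [← main i j s t hi hj hij.1 hij.2, ← main j i s t hj hi hij.2 hij.1]
      exact h.comm _ _ _ _
    · have := not_and_or.1 hij
      rw [zero i j s t this, zero j i s t this.symm]

/-! ### Twins -/

/-- Two vertices are twins if they have the same out- and in-neighbours. -/
def Twin (A : V → V → Prop) (x y : V) : Prop :=
  ∀ z, (A x z ↔ A y z) ∧ (A z x ↔ A z y)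

theorem twin_equivalence (A : V → V → Prop) : Equivalence (Twin A) where
  refl _ _ := ⟨Iff.rfl, Iff.rfl⟩
  symm h z := ⟨(h z).1.symm, (h z).2.symm⟩
  trans h k z := ⟨(h z).1.trans (k z).1, (h z).2.trans (k z).2⟩

theorem Twin.hasPath_left {A : V → V → Prop} {x x' y : V} (h : Twin A x x') {n : ℕ} :
    HasPathOfLength A x y (n + 1) ↔ HasPathOfLength A x' y (n + 1) := by
  simp only [hasPath_succ, (h _).1]

theorem Twin.hasPath_right {A : V → V → Prop} {x x' y : V} (h : Twin A x x') {n : ℕ} :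
    HasPathOfLength A y x (n + 1) ↔ HasPathOfLength A y x' (n + 1) := by
  simp only [hasPath_succ', (h _).2]

theorem Twin.ddist_left {A : V → V → Prop} {x x' y : V} (h : Twin A x x') (h1 : x ≠ y)
    (h2 : x' ≠ y) : ddist A x y = ddist A x' y := by
  unfold ddist
  congr 1; ext n
  rcases n with _ | n
  · simp [hasPath_zero, h1, h2]
  · exact h.hasPath_left

theorem Twin.ddist_right {A : V → V → Prop} {x x' y : V} (h : Twin A x x') (h1 : x ≠ y)
    (h2 : x' ≠ y) : ddist A y x = ddist A y x' := by
  unfold ddist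
  congr 1; ext n
  rcases n with _ | n
  · simp [hasPath_zero, h1.symm, h2.symm]
  · exact h.hasPath_right

theorem Twin.ddist_symm {A : V → V → Prop} {x y : V} (h : Twin A x y) :
    ddist A x y = ddist A y x := by
  unfold ddist
  congr 1; ext n
  rcases n with _ | n
  · simp [hasPath_zero, eq_comm]
  · exact h.hasPath_left.trans h.hasPath_right.symm

theorem Twin.tdist_eq {A : V → V → Prop} {x x' y y' : V} (h : Twin A x x') (k : Twin A y y')
    (hxy : ¬ Twin A x y) : tdist A x y = tdist A x' y' := by
  have e := twin_equivalence A
  have ne : ∀ {u v}, Twin A x u → Twin A y v → u ≠ v := by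
    rintro u v hu hv rfl
    exact hxy (e.trans hu (e.symm hv))
  have r := e.refl
  unfold tdist
  rw [h.ddist_left (ne (r x) (r y)) (ne h (r y)), h.ddist_right (ne (r x) (r y)) (ne h (r y)),
    k.ddist_left (ne h (r y)).symm (ne h k).symm, k.ddist_right (ne h (r y)).symm (ne h k).symm]

theorem arc_iff {A : V → V → Prop} (hirr : ∀ x, ¬ A x x) (h : IsCWDRD A) (x y : V) :
    (tdist A x y).1 = 1 ↔ A x y := ddist_eq_one hirr h.1.1

theorem arc_iff' {A : V → V → Prop} (hirr : ∀ x, ¬ A x x) (h : IsCWDRD A) (x y : V) :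
    (tdist A x y).2 = 1 ↔ A y x := ddist_eq_one hirr h.1.1

theorem outdegree_eq [Fintype V] {A : V → V → Prop} (hirr : ∀ x, ¬ A x x) (h : IsCWDRD A)
    (x y : V) : {z | A x z}.ncard = {z | A y z}.ncard := by
  have := h.isCScheme.cval_reg (fun i => i.1 = 1) x y
  simpa only [cval, arc_iff hirr h] using this

theorem indegree_eq [Fintype V] {A : V → V → Prop} (hirr : ∀ x, ¬ A x x) (h : IsCWDRD A)
    (x y : V) : {z | A z x}.ncard = {z | A z y}.ncard := by
  have := h.isCScheme.cval_reg (fun i => i.2 = 1) x y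
  simpa only [cval, arc_iff' hirr h] using this

theorem twin_of_ncard [Fintype V] {A : V → V → Prop} (hirr : ∀ x, ¬ A x x) (h : IsCWDRD A)
    {x y : V} (h1 : {z | A x z}.ncard ≤ {z | A x z ∧ A y z}.ncard)
    (h2 : {z | A z x}.ncard ≤ {z | A z x ∧ A z y}.ncard) : Twin A x y := by
  have a1 := of_ncard_le (fun z (hz : A x z ∧ A y z) => hz.1) h1
  have a2 := of_ncard_le (fun z (hz : A x z ∧ A y z) => hz.2) ((outdegree_eq hirr h y x).le.trans h1)
  have a3 := of_ncard_le (fun z (hz : A z x ∧ A z y) => hz.1) h2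
  have a4 := of_ncard_le (fun z (hz : A z x ∧ A z y) => hz.2) ((indegree_eq hirr h y x).le.trans h2)
  exact fun z => ⟨⟨fun hz => (a1 z hz).2, fun hz => (a2 z hz).1⟩,
    ⟨fun hz => (a3 z hz).2, fun hz => (a4 z hz).1⟩⟩

theorem Twin.of_tdist_eq [Fintype V] {A : V → V → Prop} (hirr : ∀ x, ¬ A x x) (h : IsCWDRD A)
    {x y x' y' : V} (e : tdist A x y = tdist A x' y') (t : Twin A x y) : Twin A x' y' := by
  have h1 := h.isCScheme.cset_reg (fun i => i.1 = 1) (fun i => i.2 = 1) e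
  have h2 := h.isCScheme.cset_reg (fun i => i.2 = 1) (fun i => i.1 = 1) e
  simp only [cset, arc_iff hirr h, arc_iff' hirr h] at h1 h2
  apply twin_of_ncard hirr h
  · rw [← h1, ← outdegree_eq hirr h x x']
    exact ncard_mono_set fun z hz => ⟨hz, (t z).1.1 hz⟩
  · rw [← h2, ← indegree_eq hirr h x x']
    exact ncard_mono_set fun z hz => ⟨hz, (t z).2.1 hz⟩

/-- Non-adjacency (including equality) is transitive. -/
def NonadjTrans (A : V → V → Prop) : Prop :=
  ∀ x y z, ¬ (A x y ∨ A y x) → ¬ (A y z ∨ A z y) → ¬ (A x z ∨ A z x)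

theorem exists_twin_quotient [Fintype V] [Nonempty V] {A : V → V → Prop} (hirr : ∀ x, ¬ A x x)
    (h : IsCWDRD A) :
    ∃ (N n : ℕ) (S : Fin N → Fin N → Prop), 0 < N ∧ 0 < n ∧ Iso A (cocliqueExt S n) ∧
      (∀ s, ¬ S s s) ∧ IsCWDRD S ∧ (∀ s t, Twin S s t → s = t) ∧
      (n = 1 ∨ ((∃ s t, S s t ∧ S t s) → ∀ s t, tdist S s t ≠ (2, 2))) := by
  obtain ⟨N, π, hsurj, hπ⟩ := exists_labelling (Twin A) (twin_equivalence A)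
  have hsc := h.1.1
  choose σ hσ using hsurj
  obtain ⟨x0⟩ := ‹Nonempty V›
  have hfib : ∀ x, {y | π y = π x}.ncard = {y | Twin A x0 y}.ncard := by
    intro x
    have h1 := h.isCScheme.cval_reg (fun i => ∃ u v, Twin A u v ∧ tdist A u v = i) x x0
    have key : ∀ x z, (∃ u v, Twin A u v ∧ tdist A u v = tdist A x z) ↔ Twin A x z :=
      fun x z => ⟨fun ⟨u, v, t, e⟩ => t.of_tdist_eq hirr h e, fun t => ⟨x, z, t, rfl⟩⟩
    simp only [cval, key] at h1
    rw [← h1]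
    congr 1; ext y
    exact (hπ y x).trans ⟨(twin_equivalence A).symm, (twin_equivalence A).symm⟩
  set n := {y | Twin A x0 y}.ncard with hn
  have hn' : ∀ s, {y | π y = s}.ncard = n := fun s => by
    have := hfib (σ s); rwa [hσ] at this
  have hn0 : 0 < n := ncard_pos_iff.2 ⟨x0, (twin_equivalence A).refl x0⟩
  let S : Fin N → Fin N → Prop := fun s t => A (σ s) (σ t)
  have tw : ∀ x, Twin A (σ (π x)) x := fun x => (hπ _ _).1 (hσ _)
  have hS : ∀ x y, S (π x) (π y) ↔ A x y := fun x y =>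
    ((tw x) _).1.trans ((tw y) _).2
  have hpath : ∀ s t k, HasPathOfLength S s t k ↔ HasPathOfLength A (σ s) (σ t) k := by
    intro s t k
    constructor
    · rintro ⟨p, h0, h1, h2⟩
      exact ⟨fun i => σ (p i), by simp [h0], by simp [h1], h2⟩
    · rintro ⟨p, h0, h1, h2⟩
      exact ⟨fun i => π (p i), by simp [h0, hσ], by simp [h1, hσ], fun i hi => (hS _ _).2 (h2 i hi)⟩
  have hdd : ∀ s t, tdist S s t = tdist A (σ s) (σ t) := by
    intro s t; simp only [tdist, ddist, hpath]
  have hcol : ∀ x y, π x ≠ π y → tdist A x y = tdist A (σ (π x)) (σ (π y)) := fun x y hxy =>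
    Twin.tdist_eq ((twin_equivalence A).symm (tw x)) ((twin_equivalence A).symm (tw y))
      (fun t => hxy ((hπ _ _).2 t))
  have hsch : IsCScheme (tdist S) := by
    have := h.isCScheme.quotient hσ hn0 hn'
      (fun x y x' y' e e' => (hπ _ _).2 (((hπ _ _).1 e').of_tdist_eq hirr h e)) hcol
    simp only [← hdd] at this
    exact this
  have hSirr : ∀ s, ¬ S s s := fun s => hirr _
  have hSc : IsCWDRD S := by
    refine hsch.isCWDRD (fun s t => ?_) ?_
    · obtain ⟨k, hk⟩ := hsc (σ s) (σ t)
      exact ⟨k, (hpath _ _ _).2 hk⟩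
    · obtain ⟨d, ⟨x, y, rfl⟩, hd⟩ := h.1.2.1
      refine ⟨tdist A x y, ⟨π x, π y, ?_⟩, hd⟩
      rw [hdd]
      exact (hcol x y fun e => hd ((hπ _ _).1 e).ddist_symm).symm
  refine ⟨N, n, S, Fin.pos (π x0), hn0, ?_, hSirr, hSc, ?_, ?_⟩
  · obtain ⟨e, he⟩ := exists_fibre_equiv π hn'
    refine ⟨e, fun x y => ?_⟩
    simp only [cocliqueExt, lexProd, he, and_false, or_false, hS]
  · intro s t hst
    have : Twin A (σ s) (σ t) := by
      intro z
      have h1 := hst (π z)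
      rw [← hσ s, ← hσ t] at h1
      simpa only [hS] using h1
    rw [← hσ s, ← hσ t]
    exact (hπ _ _).2 this
  · by_cases hn1 : n = 1
    · exact Or.inl hn1
    right
    rintro ⟨s0, t0, he1, he2⟩ s t hst
    have h2 : 1 < {y | Twin A x0 y}.ncard := by omega
    obtain ⟨u, hu, v, hv, huv⟩ := (Set.one_lt_ncard (Set.toFinite _)).1 h2
    have tuv : Twin A u v := (twin_equivalence A).trans ((twin_equivalence A).symm hu) hv
    have h11 := h.isCScheme.cval_reg (fun i => i = (1, 1)) (σ s0) u
    have e11 : ∀ x y, tdist A x y = (1, 1) ↔ A x y ∧ A y x := by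
      intro x y
      rw [Prod.ext_iff, arc_iff hirr h, arc_iff' hirr h]
    simp only [cval, e11] at h11
    have : 0 < {z | A u z ∧ A z u}.ncard := by
      rw [← h11, ncard_pos_iff]; exact ⟨σ t0, he1, he2⟩
    obtain ⟨z, hz1, hz2⟩ := ncard_pos_iff.1 this
    have hnadj : ¬ A u v := fun e => hirr v ((tuv v).1.1 e)
    have hnadj' : ¬ A v u := fun e => hirr v ((tuv v).2.1 e)
    have huv2 : tdist A u v = (2, 2) := by
      rw [Prod.ext_iff]
      exact ⟨(ddist_eq_two hirr hsc).2 ⟨huv, hnadj, z, hz1, (tuv z).2.1 hz2⟩,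
        (ddist_eq_two hirr hsc).2 ⟨huv.symm, hnadj', z, (tuv z).1.1 hz1, hz2⟩⟩
    rw [hdd] at hst
    have := tuv.of_tdist_eq hirr h (huv2.trans hst.symm)
    have hst' := (hπ _ _).2 this
    rw [hσ, hσ] at hst'
    subst hst'
    rw [(h.isCScheme.diag _ _).2 rfl] at hst
    simp at hst

/-! ### Twin-free digraphs -/

/-- Combinatorial properties of the two-way distance `c` of a twin-free semicomplete multipartite
commutative weakly distance-regular digraph with arc relation `A`. -/
structure IsReduced (A : V → V → Prop) (c : V → V → ℕ × ℕ) : Prop where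
  sch : IsCScheme c
  arc : ∀ x y, (c x y).1 = 1 ↔ A x y
  colors : ∀ x y, c x y = (0, 0) ∨ c x y = (2, 2) ∨ c x y = (1, 1) ∨ c x y = (1, 2) ∨
    c x y = (2, 1) ∨ c x y = (1, 3) ∨ c x y = (3, 1)
  trans : ∀ x y z, c x y = (2, 2) → c y z = (2, 2) → x = z ∨ c x z = (2, 2)
  far : ∀ x y, c x y = (1, 3) → ∀ z, A y z → ¬ A z x
  near : ∀ x y, c x y = (1, 2) → ∃ z, A y z ∧ A z x
  twinfree : ∀ x y, Twin A x y → x = y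
  exists_nonadj : ∃ x y, c x y = (2, 2)
  exists_asymm : ∃ x y, A x y ∧ ¬ A y x

theorem exists_two_path [Fintype V] {A : V → V → Prop} (hirr : ∀ x, ¬ A x x) (h : IsCWDRD A)
    (htw : ∀ s t, Twin A s t → s = t) (hna : NonadjTrans A) {x y : V} (hne : x ≠ y)
    (hxy : ¬ (A x y ∨ A y x)) : ∃ z, A x z ∧ A z y := by
  by_contra! hno
  have hyx : ¬ (A y x ∨ A x y) := fun e => hxy e.symm
  have adj : ∀ z, (A x z ∨ A z x) ↔ (A y z ∨ A z y) := fun z =>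
    ⟨fun e => by_contra fun e' => hna x y z hxy e' e,
      fun e => by_contra fun e' => hna y x z hyx e' e⟩
  have h1 : ∀ z, A x z → A y z := fun z hz =>
    ((adj z).1 (Or.inl hz)).resolve_right (hno z hz)
  have h2 := of_ncard_le h1 (outdegree_eq hirr h y x).le
  have e11 : ∀ x y, tdist A x y = (1, 1) ↔ A x y ∧ A y x := by
    intro x y
    rw [Prod.ext_iff, arc_iff hirr h, arc_iff' hirr h]
  have h11 := h.isCScheme.cval_reg (fun i => i = (1, 1)) x y
  simp only [cval, e11] at h11
  have hy : {z | A y z ∧ A z y}.ncard = 0 :=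
    ncard_zero_iff.2 fun z hz => hno z (h2 z hz.1) hz.2
  rw [hy] at h11
  have hx := ncard_zero_iff.1 h11
  refine hne (htw x y fun z => ⟨⟨h1 z, h2 z⟩, ⟨fun hz => ?_, fun hz => ?_⟩⟩)
  · exact ((adj z).1 (Or.inr hz)).resolve_left fun e => hx z ⟨h2 z e, hz⟩
  · exact ((adj z).2 (Or.inr hz)).resolve_left fun e => hno z e hz

theorem ddist_back_le [Fintype V] {A : V → V → Prop} (hirr : ∀ x, ¬ A x x) (h : IsCWDRD A)
    (htw : ∀ s t, Twin A s t → s = t) (hna : NonadjTrans A) {x y : V} (hxy : A x y)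
    (hyx : ¬ A y x) : ddist A y x ≤ 3 := by
  have : ∃ z, A y z ∧ ¬ A x z := by
    by_contra! hno
    exact hirr y (of_ncard_le hno (outdegree_eq hirr h x y).le y hxy)
  obtain ⟨z, hyz, hxz⟩ := this
  by_cases hzx : A z x
  · exact (ddist_le (hasPath_two.2 ⟨z, hyz, hzx⟩)).trans (by norm_num)
  have hne : z ≠ x := by rintro rfl; exact hyx hyz
  obtain ⟨w, hw⟩ := exists_two_path hirr h htw hna hne (by tauto)
  exact ddist_le (hasPath_succ.2 ⟨z, hyz, hasPath_two.2 ⟨w, hw⟩⟩)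

theorem IsCWDRD.isReduced [Fintype V] {A : V → V → Prop} (hirr : ∀ x, ¬ A x x) (h : IsCWDRD A)
    (htw : ∀ s t, Twin A s t → s = t) (hna : NonadjTrans A)
    (hex : ∃ x y, x ≠ y ∧ ¬ (A x y ∨ A y x)) : IsReduced A (tdist A) := by
  have hsc := h.1.1
  have e22 : ∀ x y, tdist A x y = (2, 2) ↔ x ≠ y ∧ ¬ (A x y ∨ A y x) := by
    intro x y
    simp only [tdist, Prod.mk.injEq, ddist_eq_two hirr hsc]
    constructor
    · tauto
    · intro hh
      exact ⟨⟨hh.1, by tauto, exists_two_path hirr h htw hna hh.1 hh.2⟩,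
        ⟨hh.1.symm, by tauto, exists_two_path hirr h htw hna hh.1.symm (by tauto)⟩⟩
  have hasym : ∀ x y, A x y → ¬ A y x → tdist A x y = (1, 2) ∨ tdist A x y = (1, 3) := by
    intro x y h1 h2
    have h3 := ddist_back_le hirr h htw hna h1 h2
    have h4 : ddist A y x ≠ 1 := mt (ddist_eq_one hirr hsc).1 h2
    have h5 : ddist A y x ≠ 0 := fun e => by
      rw [ddist_eq_zero hsc] at e; subst e; exact h2 h1
    have h6 : ddist A x y = 1 := (ddist_eq_one hirr hsc).2 h1
    simp only [tdist, Prod.mk.injEq, h6, true_and]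
    omega
  refine ⟨h.isCScheme, arc_iff hirr h, ?_, ?_, ?_, ?_, htw, ?_, ?_⟩
  · intro x y
    by_cases hxy : x = y
    · exact Or.inl ((h.isCScheme.diag x y).2 hxy)
    by_cases h1 : A x y <;> by_cases h2 : A y x
    · right; right; left
      rw [Prod.ext_iff, arc_iff hirr h, arc_iff' hirr h]; exact ⟨h1, h2⟩
    · rcases hasym x y h1 h2 with e | e <;> simp [e]
    · have e0 := h.isCScheme.swap y x
      rcases hasym y x h2 h1 with e | e <;> simp [e0, e]
    · right; left
      exact (e22 x y).2 ⟨hxy, by tauto⟩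
  · intro x y z h1 h2
    by_cases hxz : x = z
    · exact Or.inl hxz
    · exact Or.inr ((e22 x z).2 ⟨hxz, hna x y z ((e22 x y).1 h1).2 ((e22 y z).1 h2).2⟩)
  · intro x y hxy z h1 h2
    have := ddist_le (hasPath_two.2 ⟨z, h1, h2⟩)
    have h3 : ddist A y x = 3 := (Prod.ext_iff.1 hxy).2
    omega
  · intro x y hxy
    have h3 : ddist A y x = 2 := (Prod.ext_iff.1 hxy).2
    exact ((ddist_eq_two hirr hsc).1 h3).2.2
  · obtain ⟨x, y, hxy⟩ := hex
    exact ⟨x, y, (e22 x y).2 hxy⟩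
  · by_contra! hsym
    obtain ⟨d, ⟨x, y, rfl⟩, hd⟩ := h.1.2.1
    apply hd
    by_cases hxy : x = y
    · rw [(h.isCScheme.diag x y).2 hxy]
    by_cases h1 : A x y
    · have h2 := hsym x y h1
      rw [(arc_iff hirr h x y).2 h1, (arc_iff' hirr h x y).2 h2]
    · have h2 : ¬ A y x := fun e => h1 (hsym y x e)
      rw [(e22 x y).2 ⟨hxy, by tauto⟩]

/-- The relation of lying in the same partite set. -/
def same (c : V → V → ℕ × ℕ) (x y : V) : Prop := x = y ∨ c x y = (2, 2)

/-- The number of vertices `w` in the partite set of `y` such that the colour of `(x,w)`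
satisfies `K`. -/
noncomputable def partCount (c : V → V → ℕ × ℕ) (K : ℕ × ℕ → Prop) (x y : V) : ℕ :=
  {w | K (c x w) ∧ same c w y}.ncard

namespace IsReduced

variable {A : V → V → Prop} {c : V → V → ℕ × ℕ}

theorem arc' (h : IsReduced A c) (x y : V) : (c x y).2 = 1 ↔ A y x := by
  rw [← h.arc, h.sch.swap x y]; rfl

theorem same_equiv (h : IsReduced A c) : Equivalence (same c) where
  refl x := Or.inl rfl
  symm := by
    rintro x y (rfl | e)
    · exact Or.inl rfl
    · right; rw [h.sch.swap x y, e]; rfl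
  trans := by
    rintro x y z (rfl | e) (rfl | e')
    · exact Or.inl rfl
    · exact Or.inr e'
    · exact Or.inr e
    · exact h.trans x y z e e'

theorem irrefl (h : IsReduced A c) (x : V) : ¬ A x x := by
  rw [← h.arc, (h.sch.diag x x).2 rfl]; simp

theorem adj_iff (h : IsReduced A c) (x y : V) : (A x y ∨ A y x) ↔ ¬ same c x y := by
  rw [← h.arc, ← h.arc', same, ← h.sch.diag]
  rcases h.colors x y with e | e | e | e | e | e | e <;> simp [e]

theorem not_same_of_arc (h : IsReduced A c) {x y : V} (hxy : A x y) : ¬ same c x y :=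
  (h.adj_iff x y).1 (Or.inl hxy)

theorem not_same_of_arc' (h : IsReduced A c) {x y : V} (hxy : A x y) : ¬ same c y x :=
  (h.adj_iff y x).1 (Or.inr hxy)

theorem arc_colors (h : IsReduced A c) {x y : V} (hxy : A x y) :
    c x y = (1, 1) ∨ c x y = (1, 2) ∨ c x y = (1, 3) := by
  rw [← h.arc] at hxy
  rcases h.colors x y with e | e | e | e | e | e | e <;> simp [e] at hxy ⊢

theorem edge_iff (h : IsReduced A c) (x y : V) : c x y = (1, 1) ↔ A x y ∧ A y x := by
  rw [Prod.ext_iff, h.arc, h.arc']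

theorem same_iff (h : IsReduced A c) (x y : V) :
    same c x y ↔ (c x y = (0, 0) ∨ c x y = (2, 2)) := by
  rw [same, h.sch.diag]

theorem partCount_eq_cset (h : IsReduced A c) (K : ℕ × ℕ → Prop) (x y : V) :
    partCount c K x y = cset c K (fun i => i = (0, 0) ∨ i = (2, 2)) x y := by
  unfold partCount cset
  simp only [h.same_iff]

/-- `(x,y)` of colour `(1,3)`: each out-neighbour of `y` is an out-neighbour of `x` or lies in
the partite set of `x`. -/
theorem far_out (h : IsReduced A c) {x y w : V} (hxy : c x y = (1, 3)) (hw : A y w)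
    (hs : ¬ same c w x) : A x w :=
  ((h.adj_iff w x).2 hs).resolve_left (h.far x y hxy w hw)

theorem far_arc (h : IsReduced A c) {x y : V} (hxy : c x y = (1, 3)) : A x y := by
  rw [← h.arc, hxy]

theorem partCount_right (h : IsReduced A c) (K : ℕ × ℕ → Prop) {x y y' : V}
    (e : same c y y') : partCount c K x y = partCount c K x y' :=
  ncard_congr_set fun _ => and_congr_right fun _ =>
    ⟨fun hs => h.same_equiv.trans hs e, fun hs => h.same_equiv.trans hs (h.same_equiv.symm e)⟩

variable [Fintype V]

theorem partCount_reg (h : IsReduced A c) (K : ℕ × ℕ → Prop) {x y x' y' : V}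
    (e : c x y = c x' y') : partCount c K x y = partCount c K x' y' := by
  rw [h.partCount_eq_cset, h.partCount_eq_cset, h.sch.cset_reg K _ e]

theorem partCount_swap (h : IsReduced A c) (K : ℕ × ℕ → Prop) (x y : V) :
    partCount c K x y = partCount c (fun i => K i.swap) y x := by
  rw [h.partCount_eq_cset, h.partCount_eq_cset, h.sch.cset_comm, h.sch.cset_swap]
  unfold cset
  congr 1; ext z
  simp only [Set.mem_ofPred_eq, Prod.ext_iff, Prod.fst_swap, Prod.snd_swap]
  tauto

theorem partCount_left (h : IsReduced A c) (K : ℕ × ℕ → Prop) {x x' y : V}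
    (e : same c x x') : partCount c K x y = partCount c K x' y := by
  rw [h.partCount_swap, h.partCount_right _ e, ← h.partCount_swap]

/-- If a partite set carries two mutually transposed colours, its profile is symmetric. -/
theorem partCount_symm (h : IsReduced A c) {x y w w' : V} (hw : same c w y) (hw' : same c w' y)
    (e : c x w' = (c x w).swap) (K : ℕ × ℕ → Prop) :
    partCount c K x y = partCount c (fun i => K i.swap) x y := by
  rw [← h.partCount_right K hw', h.partCount_reg K (e.trans (h.sch.swap x w).symm),
    h.partCount_swap, h.partCount_right _ hw]

theorem partCount_pos (h : IsReduced A c) {K : ℕ × ℕ → Prop} {x y : V} :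
    0 < partCount c K x y ↔ ∃ w, K (c x w) ∧ same c w y := by
  have := h.sch
  exact ncard_pos_iff

theorem partCount_eq_zero (h : IsReduced A c) {K : ℕ × ℕ → Prop} {x y : V} :
    partCount c K x y = 0 ↔ ∀ w, same c w y → ¬ K (c x w) := by
  have := h.sch
  unfold partCount
  rw [ncard_zero_iff]
  exact forall_congr' fun w => ⟨fun k k1 k2 => k ⟨k2, k1⟩, fun k k1 => k k1.2 k1.1⟩

theorem partCount_singleton_swap (h : IsReduced A c) (i : ℕ × ℕ) (x y : V) :
    partCount c (fun j => j = i) x y = partCount c (fun j => j = i.swap) y x := by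
  rw [h.partCount_swap]
  exact ncard_congr_set fun w => by simp only [Prod.swap_eq_iff_eq_swap]

theorem outdegree (h : IsReduced A c) (x y : V) : {z | A x z}.ncard = {z | A y z}.ncard := by
  have := h.sch.cval_reg (fun i => i.1 = 1) x y
  simpa only [cval, h.arc] using this

theorem ncard_diff (h : IsReduced A c) (x y : V) :
    {w | A x w ∧ ¬ A y w}.ncard = {w | A y w ∧ ¬ A x w}.ncard := by
  have h1 := ncard_split (fun w => A x w) (fun w => A y w)
  have h2 := ncard_split (fun w => A y w) (fun w => A x w)
  have h3 := h.outdegree x y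
  have h4 : {w | A x w ∧ A y w}.ncard = {w | A y w ∧ A x w}.ncard :=
    ncard_congr_set fun w => and_comm
  omega

theorem ncard_diff_le (h : IsReduced A c) {x y : V} (hxy : c x y = (1, 3)) :
    {w | A y w ∧ ¬ A x w}.ncard ≤ partCount c (fun i => i.1 = 1) y x := by
  refine ncard_mono_set fun w hw => ⟨(h.arc y w).2 hw.1, by_contra fun hs => hw.2 ?_⟩
  exact h.far_out hxy hw.1 hs

/-- A vertex outside the partite sets of `x` and `y`, dominated by `x`, is dominated by `y`. -/
theorem far_out' (h : IsReduced A c) {x y w : V} (hxy : c x y = (1, 3))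
    (H : partCount c (fun i => i.1 = 1) y x ≤ partCount c (fun i => i.1 = 1) x y)
    (hw : A x w) (hs : ¬ same c w y) : A y w := by
  by_contra hyw
  have h1 : {w | A x w ∧ ¬ A y w}.ncard ≤ partCount c (fun i => i.1 = 1) x y := by
    rw [h.ncard_diff]; exact (h.ncard_diff_le hxy).trans H
  have := of_ncard_le (p := fun w => (c x w).1 = 1 ∧ same c w y)
    (q := fun w => A x w ∧ ¬ A y w)
    (fun w hw => ⟨(h.arc x w).1 hw.1, fun e => h.not_same_of_arc' e hw.2⟩) h1 w ⟨hw, hyw⟩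
  exact hs this.2

theorem far_far (h : IsReduced A c) {x y y' : V} (hxy : c x y = (1, 3)) (hxy' : c x y' = (1, 3))
    (H : ∀ x y, c x y = (1, 3) →
      partCount c (fun i => i.1 = 1) y x ≤ partCount c (fun i => i.1 = 1) x y)
    (hs : ¬ same c y y') : A y y' ∧ A y' y :=
  ⟨h.far_out' hxy (H _ _ hxy) (h.far_arc hxy') fun e => hs (h.same_equiv.symm e),
    h.far_out' hxy' (H _ _ hxy') (h.far_arc hxy) hs⟩

theorem exists_far_back (h : IsReduced A c) {x y : V} (hxy : c x y = (1, 3)) :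
    ∃ w, A y w ∧ same c w x := by
  have h1 : 0 < {w | A x w ∧ ¬ A y w}.ncard :=
    ncard_pos_iff.2 ⟨y, h.far_arc hxy, h.irrefl y⟩
  rw [h.ncard_diff] at h1
  obtain ⟨w, hw⟩ := ncard_pos_iff.1 (h1.trans_le (h.ncard_diff_le hxy))
  exact ⟨w, (h.arc _ _).1 hw.1, hw.2⟩

/-- The profile of the partite set of `y` seen from `x`, for `(x,y)` of colour `(1,3)`. -/
theorem far_profile (h : IsReduced A c) {x y : V} (hxy : c x y = (1, 3)) :
    (∀ K : ℕ × ℕ → Prop, partCount c K x y = partCount c (fun i => K i.swap) x y) ∨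
    ((∀ w, same c w y → c x w = (1, 3) ∨ c x w = (2, 1)) ∧ ∃ w, same c w y ∧ c x w = (2, 1)) := by
  by_cases hsym : ∃ w w', same c w y ∧ same c w' y ∧ c x w' = (c x w).swap
  · obtain ⟨w, w', hw, hw', e⟩ := hsym
    exact Or.inl (h.partCount_symm hw hw' e)
  right
  push Not at hsym
  obtain ⟨v, hv, hvx⟩ := h.exists_far_back hxy
  have h1 : 0 < partCount c (fun i => i.1 = 1) y x :=
    h.partCount_pos.2 ⟨v, (h.arc _ _).2 hv, hvx⟩
  rw [h.partCount_swap] at h1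
  obtain ⟨w, hw, hwy⟩ := h.partCount_pos.1 h1
  have hyy : same c y y := h.same_equiv.refl y
  have hw21 : c x w = (2, 1) := by
    have e1 := hsym w w hwy hwy
    have e2 := hsym w y hwy hyy
    rw [hxy] at e2
    rcases h.colors x w with e | e | e | e | e | e | e <;> simp [e] at hw e1 e2 ⊢
  refine ⟨fun u hu => ?_, w, hwy, hw21⟩
  have hnu : ¬ same c x u := fun e =>
    h.not_same_of_arc (h.far_arc hxy) (h.same_equiv.trans e hu)
  have e1 := hsym u u hu hu
  have e2 := hsym u w hu hwy
  have e3 := hsym u y hu hyy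
  rw [h.same_iff] at hnu
  rw [hw21] at e2
  rw [hxy] at e3
  rcases h.colors x u with e | e | e | e | e | e | e <;> simp [e] at hnu e1 e2 e3 ⊢

end IsReduced

/-- Every partite set containing a vertex at two-way distance `(1,3)` from `x` has a symmetric
profile with respect to `x`. -/
structure IsFarSymm (A : V → V → Prop) (c : V → V → ℕ × ℕ) : Prop extends IsReduced A c where
  profile : ∀ x y, c x y = (1, 3) → ∀ K : ℕ × ℕ → Prop,
    partCount c K x y = partCount c (fun i => K i.swap) x y
  exists_far : ∃ x y, c x y = (1, 3)
  exists_near : ∃ x y, c x y = (1, 2)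

theorem swap_eq_of_eq {A : V → V → Prop} {c : V → V → ℕ × ℕ} (h : IsReduced A c) {x y : V}
    {a b : ℕ} (e : c x y = (a, b)) : c y x = (b, a) := by
  rw [h.sch.swap x y, e]; rfl

namespace IsFarSymm

variable [Fintype V] {A : V → V → Prop} {c : V → V → ℕ × ℕ}

theorem out_le (h : IsFarSymm A c) (x y : V) (hxy : c x y = (1, 3)) :
    partCount c (fun i => i.1 = 1) y x ≤ partCount c (fun i => i.1 = 1) x y := by
  rw [h.partCount_swap, h.profile x y hxy]
  rfl

theorem edge_same (h : IsFarSymm A c) {x y w : V} (hxy : c x y = (1, 3)) (h1 : A x w)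
    (h2 : A w x) : same c w y := by
  by_contra hs
  exact h.far x y hxy w (h.far_out' hxy (h.out_le x y hxy) h1 hs) h2

theorem exists_far_in (h : IsFarSymm A c) {x y : V} (hxy : c x y = (1, 3)) :
    ∃ w, c w x = (1, 3) ∧ same c w y := by
  have h1 : 0 < partCount c (fun i => i = (1, 3)) x y :=
    h.partCount_pos.2 ⟨y, hxy, h.same_equiv.refl y⟩
  rw [h.profile x y hxy] at h1
  obtain ⟨w, hw, hs⟩ := h.partCount_pos.1 h1
  refine ⟨w, ?_, hs⟩
  rw [h.sch.swap x w]; exact hw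

theorem exists_far_out (h : IsFarSymm A c) {x y : V} (hxy : c x y = (1, 3)) :
    ∃ w, c y w = (1, 3) ∧ same c w x := by
  obtain ⟨w, hw, hs⟩ := h.exists_far_in hxy
  have h1 : 0 < partCount c (fun i => i = (3, 1)) x y :=
    h.partCount_pos.2 ⟨w, swap_eq_of_eq h.toIsReduced hw, hs⟩
  rw [h.partCount_swap] at h1
  obtain ⟨v, hv, hs⟩ := h.partCount_pos.1 h1
  exact ⟨v, Prod.swap_injective hv, hs⟩

theorem edge_same' (h : IsFarSymm A c) {x y w : V} (hxy : c x y = (1, 3)) (h1 : A y w)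
    (h2 : A w y) : same c w x := by
  obtain ⟨v, hv, hs⟩ := h.exists_far_out hxy
  exact h.same_equiv.trans (h.edge_same hv h1 h2) hs

theorem far_same (h : IsFarSymm A c) {x y y' : V} (hxy : c x y = (1, 3)) (hxy' : c x y' = (1, 3)) :
    same c y y' := by
  by_contra hs
  obtain ⟨h1, h2⟩ := h.far_far hxy hxy' h.out_le hs
  exact h.not_same_of_arc' (h.far_arc hxy') (h.edge_same' hxy h1 h2)

theorem far_same_in (h : IsFarSymm A c) {x y y' : V} (hxy : c x y = (1, 3))
    (hxy' : c y' x = (1, 3)) : same c y' y := by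
  obtain ⟨v, hv, hs⟩ := h.exists_far_out hxy'
  exact h.same_equiv.trans (h.same_equiv.symm hs) (h.far_same hv hxy)

theorem out_iff (h : IsFarSymm A c) {x y w : V} (hxy : c x y = (1, 3)) (hx : ¬ same c w x)
    (hy : ¬ same c w y) : A x w ↔ A y w :=
  ⟨fun e => h.far_out' hxy (h.out_le x y hxy) e hy, fun e => h.far_out hxy e hx⟩

end IsFarSymm

theorem cset_eq_cset [Fintype V] {c : V → V → ℕ × ℕ} (h : IsCScheme c) (i j : ℕ × ℕ)
    {x y x' y' : V} (e : c x y = c x' y') :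
    {z | c x z = i ∧ c z y = j}.ncard = {z | c x' z = i ∧ c z y' = j}.ncard :=
  h.reg i j x y x' y' e

namespace IsFarSymm

variable [Fintype V] {A : V → V → Prop} {c : V → V → ℕ × ℕ}

theorem exists_far_from (h : IsFarSymm A c) (x : V) : ∃ y, c x y = (1, 3) := by
  obtain ⟨x₀, y₀, e⟩ := h.exists_far
  have h1 : 0 < cval c (fun i => i = (1, 3)) x₀ := ncard_pos_iff.2 ⟨y₀, e⟩
  rw [h.sch.cval_reg _ x₀ x] at h1
  exact ncard_pos_iff.1 h1

theorem far_path_same (h : IsFarSymm A c) {x y z : V} (hxy : c x y = (1, 3))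
    (hyz : c y z = (1, 3)) : c x z = (2, 2) := by
  obtain ⟨v, hv, hs⟩ := h.exists_far_out hxy
  rcases h.same_equiv.trans (h.far_same hyz hv) hs with rfl | e
  · rw [swap_eq_of_eq h.toIsReduced hyz] at hxy
    simp at hxy
  · exact swap_eq_of_eq h.toIsReduced e

theorem far_card (h : IsFarSymm A c) (x : V) :
    {y | c x y = (1, 3)}.ncard = 1 ∧ {y | c x y = (2, 2)}.ncard = 1 := by
  have hsw := fun {x y : V} {a b : ℕ} => swap_eq_of_eq (x := x) (y := y) (a := a) (b := b)
    h.toIsReduced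
  obtain ⟨y, hxy⟩ := h.exists_far_from x
  obtain ⟨x', hyx', -⟩ := h.exists_far_out hxy
  have hxx' : c x x' = (2, 2) := h.far_path_same hxy hyx'
  set a := {y | c x y = (1, 3)}.ncard with ha
  set k := {y | c x y = (2, 2)}.ncard with hk
  have ha' : ∀ z, {y | c z y = (1, 3)}.ncard = a := fun z => h.sch.cval_reg (· = (1, 3)) z x
  have ha'' : ∀ z, {y | c y z = (1, 3)}.ncard = a := fun z => by
    refine Eq.trans ?_ ((h.sch.cval_swap (· = (1, 3)) z).trans (ha' z))
    refine ncard_congr_set fun y => ⟨fun e => ?_, fun e => ?_⟩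
    · rw [hsw e]; rfl
    · rw [h.sch.swap z y, e]
  have ha0 : 0 < a := ncard_pos_iff.2 ⟨y, hxy⟩
  have hk0 : 0 < k := ncard_pos_iff.2 ⟨x', hxx'⟩
  have hmu : k * {u | c x u = (1, 3) ∧ c u x' = (1, 3)}.ncard = a * a := by
    refine double_count (p := fun z => c x z = (2, 2)) (q := fun u => c x u = (1, 3))
      (R := fun z u => c u z = (1, 3)) (fun z hz => ?_) (fun u hu => ?_)
    · exact h.sch.reg _ _ _ _ _ _ (hz.trans hxx'.symm)
    · rw [← ha' u]
      exact ncard_congr_set fun z => ⟨fun e => e.2, fun e => ⟨h.far_path_same hu e, e⟩⟩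
  have hlam : k * {u | c x u = (1, 3) ∧ c u x' = (3, 1)}.ncard = a * (a - 1) := by
    refine double_count (p := fun z => c x z = (2, 2)) (q := fun u => c x u = (1, 3))
      (R := fun z u => c u z = (3, 1)) (fun z hz => ?_) (fun u hu => ?_)
    · exact h.sch.reg _ _ _ _ _ _ (hz.trans hxx'.symm)
    · have h1 := ncard_split (fun z => c z u = (1, 3)) (fun z => z = x)
      have h2 : {z | c z u = (1, 3) ∧ z = x}.ncard = 1 := by
        rw [ncard_congr_set (q := fun z => z = x)]
        · exact Set.ncard_singleton x
        · exact fun z => ⟨fun e => e.2, by rintro rfl; exact ⟨hu, rfl⟩⟩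
      have h3 : {z | c x z = (2, 2) ∧ c u z = (3, 1)}.ncard =
          {z | c z u = (1, 3) ∧ ¬ z = x}.ncard := by
        refine ncard_congr_set fun z => ⟨fun e => ⟨hsw e.2, ?_⟩, fun e => ⟨?_, hsw e.1⟩⟩
        · rintro rfl
          rw [(h.sch.diag z z).2 rfl] at e
          simp at e
        · obtain ⟨v, hv, -⟩ := h.exists_far_out hu
          rcases h.far_same_in hv e.1 with e1 | e1
          · subst e1
            exact h.far_path_same hu hv
          · rcases h.trans _ _ _ e1 (hsw (h.far_path_same hu hv)) with e2 | e2
            · exact absurd e2 e.2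
            · exact hsw e2
      rw [h3]
      have := ha'' u
      omega
  have hr : 2 * a ≤ k + 1 := by
    have h1 : {w | c x w = (1, 3)}.ncard + {w | c w x = (1, 3)}.ncard ≤
        {w | same c w y}.ncard := by
      rw [← Set.ncard_union_eq]
      · refine ncard_mono_set fun w hw => ?_
        rcases hw with hw | hw
        · exact h.far_same hw hxy
        · exact h.far_same_in hxy hw
      · rw [Set.disjoint_left]
        intro z (hz : c x z = _) (hz' : c z x = _)
        rw [hsw hz] at hz'
        simp at hz'
    have h2 : {w | same c w y}.ncard ≤ k + 1 := by
      have : {w | same c w y} = insert y {w | c y w = (2, 2)} := by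
        ext w
        simp only [same, Set.mem_ofPred_eq, Set.mem_insert_iff]
        exact or_congr_right ⟨fun e => hsw e, fun e => hsw e⟩
      rw [this]
      refine (Set.ncard_insert_le _ _).trans ?_
      have : {w | c y w = (2, 2)}.ncard = k := h.sch.cval_reg (· = (2, 2)) y x
      omega
    have := ha'' x
    omega
  have hd : k ∣ a := by
    have d1 : k ∣ a * a := Dvd.intro _ hmu
    have d2 : k ∣ a * (a - 1) := Dvd.intro _ hlam
    have : a = a * a - a * (a - 1) := by
      rw [← Nat.mul_sub, Nat.sub_sub_self ha0]
      exact (mul_one a).symm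
    rw [this]
    exact Nat.dvd_sub d1 d2
  have := Nat.le_of_dvd ha0 hd
  omega

end IsFarSymm

/-! ### Semicomplete digraphs -/

theorem girth_eq_two {S : V → V → Prop} (hirr : ∀ s, ¬ S s s) (h : ∃ s t, S s t ∧ S t s) :
    girth S = 2 := by
  obtain ⟨s, t, h1, h2⟩ := h
  have hmem : 2 ∈ {n | 1 ≤ n ∧ HasCircuitOfLength S n} := by
    refine ⟨by norm_num, fun i => if i = 1 then t else s, rfl, fun i hi => ?_⟩
    interval_cases i
    · simpa using h1
    · simpa using h2
  refine le_antisymm (Nat.sInf_le hmem) (le_csInf ⟨2, hmem⟩ ?_)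
  rintro n ⟨hn, p, hp, hp'⟩
  by_contra hlt
  obtain rfl : n = 1 := by omega
  have := hp' 0 (by norm_num)
  rw [zero_add, hp] at this
  exact hirr _ this

theorem girth_eq_three {S : V → V → Prop} (hirr : ∀ s, ¬ S s s) (h2 : ∀ s t, S s t → ¬ S t s)
    (h : ∃ s t u, S s t ∧ S t u ∧ S u s) : girth S = 3 := by
  obtain ⟨s, t, u, h3⟩ := h
  have hmem : 3 ∈ {n | 1 ≤ n ∧ HasCircuitOfLength S n} := by
    refine ⟨by norm_num, fun i => if i = 1 then t else if i = 2 then u else s, rfl,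
      fun i hi => ?_⟩
    interval_cases i
    · simpa using h3.1
    · simpa using h3.2.1
    · simpa using h3.2.2
  refine le_antisymm (Nat.sInf_le hmem) (le_csInf ⟨3, hmem⟩ ?_)
  rintro n ⟨hn, p, hp, hp'⟩
  by_contra hlt
  obtain rfl | rfl : n = 1 ∨ n = 2 := by omega
  · have := hp' 0 (by norm_num)
    rw [zero_add, hp] at this
    exact hirr _ this
  · have h0 := hp' 0 (by norm_num)
    have h1 := hp' 1 (by norm_num)
    rw [zero_add] at h0
    rw [one_add_one_eq_two, hp] at h1
    exact h2 _ _ h0 h1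

theorem girth_of_semicomplete [Fintype V] {S : V → V → Prop} (hS : IsSemicomplete S)
    (hd : ∀ s t, {u | S s u}.ncard = {u | S t u}.ncard) (h : ∃ s t, S s t) :
    girth S = 2 ∨ girth S = 3 := by
  by_cases he : ∃ s t, S s t ∧ S t s
  · exact Or.inl (girth_eq_two hS.1 he)
  push Not at he
  refine Or.inr (girth_eq_three hS.1 he ?_)
  obtain ⟨s, t, hst⟩ := h
  by_contra! hno
  refine hS.1 t (of_ncard_le (p := fun u => S t u) (q := fun u => S s u) (fun u hu => ?_)
    (hd s t).le t hst)
  refine (hS.2 s u ?_).resolve_right (hno s t u hst hu)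
  rintro rfl
  exact he _ _ hst hu

/-- A regular tournament-like colouring is the two-way distance of its digraph. -/
theorem isCWDRD_of_tournament {N : ℕ} {S : Fin N → Fin N → Prop} {d : Fin N → Fin N → ℕ × ℕ}
    (hd : IsCScheme d) (hirr : ∀ s, ¬ S s s) (has : ∀ s t, S s t → ¬ S t s)
    (hsc : ∀ s t, s ≠ t → S s t ∨ S t s) (hcol : ∀ s t, S s t → d s t = (1, 2))
    (hback : ∀ s t, S s t → ∃ u, S t u ∧ S u s) (hex : ∃ s t, S s t) : IsCWDRD S := by
  have hc : IsStronglyConnected S := by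
    intro s t
    by_cases hst : s = t
    · exact ⟨0, hasPath_zero.2 hst⟩
    · rcases hsc s t hst with e | e
      · exact ⟨1, hasPath_one.2 e⟩
      · exact ⟨2, hasPath_two.2 (hback t s e)⟩
  have h12 : ∀ s t, S s t → tdist S s t = (1, 2) := by
    intro s t e
    refine Prod.ext ((ddist_eq_one hirr hc).2 e) ((ddist_eq_two hirr hc).2
      ⟨fun k => hirr s ?_, has s t e, hback s t e⟩)
    rwa [k] at e
  have heq : tdist S = d := by
    funext s t
    by_cases hst : s = t
    · rw [(hd.diag s t).2 hst]
      exact Prod.ext ((ddist_eq_zero hc).2 hst) ((ddist_eq_zero hc).2 hst.symm)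
    · rcases hsc s t hst with e | e
      · rw [h12 s t e, hcol s t e]
      · rw [hd.swap t s, hcol t s e, ← h12 t s e]
        rfl
  obtain ⟨s, t, e⟩ := hex
  refine IsCScheme.isCWDRD (heq ▸ hd) hc ⟨_, ⟨s, t, rfl⟩, ?_⟩
  rw [h12 s t e]
  decide

namespace IsFarSymm

variable [Fintype V] {A : V → V → Prop} {c : V → V → ℕ × ℕ}

theorem far_unique (h : IsFarSymm A c) {x y z : V} (hy : c x y = (1, 3)) (hz : c x z = (1, 3)) :
    y = z := by
  obtain ⟨w, hw⟩ := Set.ncard_eq_one.1 (h.far_card x).1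
  have hy' : y ∈ ({w} : Set V) := hw ▸ hy
  have hz' : z ∈ ({w} : Set V) := hw ▸ hz
  exact hy'.trans hz'.symm

theorem mate_unique (h : IsFarSymm A c) {x y z : V} (hy : c x y = (2, 2)) (hz : c x z = (2, 2)) :
    y = z := by
  obtain ⟨w, hw⟩ := Set.ncard_eq_one.1 (h.far_card x).2
  have hy' : y ∈ ({w} : Set V) := hw ▸ hy
  have hz' : z ∈ ({w} : Set V) := hw ▸ hz
  exact hy'.trans hz'.symm

theorem asymm (h : IsFarSymm A c) {x w : V} (h1 : A x w) : ¬ A w x := by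
  intro h2
  have hw := (h.edge_iff x w).2 ⟨h1, h2⟩
  obtain ⟨y, hy⟩ := h.exists_far_from x
  obtain ⟨y₁, hy₁, hs⟩ := h.exists_far_in hy
  have hy₁ := swap_eq_of_eq h.toIsReduced hy₁
  rcases h.edge_same hy h1 h2 with rfl | e
  · rw [hw] at hy; simp at hy
  rcases hs with rfl | e'
  · rw [hy₁] at hy; simp at hy
  have := h.mate_unique (swap_eq_of_eq h.toIsReduced e) (swap_eq_of_eq h.toIsReduced e')
  rw [this, hy₁] at hw
  simp at hw

variable {σ : V → V}

theorem iterate_mate (h : IsFarSymm A c) (hσ : ∀ x, c x (σ x) = (1, 3)) (x : V) :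
    c x (σ (σ x)) = (2, 2) := h.far_path_same (hσ x) (hσ _)

theorem iterate_four (h : IsFarSymm A c) (hσ : ∀ x, c x (σ x) = (1, 3)) (x : V) :
    σ (σ (σ (σ x))) = x :=
  (h.mate_unique (swap_eq_of_eq h.toIsReduced (h.iterate_mate hσ x)) (h.iterate_mate hσ _)).symm

theorem iterate_add_four (h : IsFarSymm A c) (hσ : ∀ x, c x (σ x) = (1, 3)) (k : ℕ) (x : V) :
    σ^[k + 4] x = σ^[k] x := by
  rw [Function.iterate_add_apply]
  exact congrArg _ (h.iterate_four hσ x)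

/-- Two vertices of the same orbit of `σ` are not joined by a pair of colour `(1,2)`. -/
theorem block_iff (h : IsFarSymm A c) (hσ : ∀ x, c x (σ x) = (1, 3)) (x y : V) :
    (c x y ≠ (1, 2) ∧ c x y ≠ (2, 1)) ↔ ∃ k < 4, y = σ^[k] x := by
  have h3 : c x (σ (σ (σ x))) = (3, 1) := by
    have := swap_eq_of_eq h.toIsReduced (hσ (σ (σ (σ x))))
    rwa [h.iterate_four hσ] at this
  constructor
  · rintro ⟨h1, h2⟩
    rcases h.colors x y with e | e | e | e | e | e | e
    · exact ⟨0, by norm_num, ((h.sch.diag x y).1 e).symm⟩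
    · exact ⟨2, by norm_num, h.mate_unique e (h.iterate_mate hσ x)⟩
    · exact absurd ((h.edge_iff x y).1 e).2 (h.asymm ((h.edge_iff x y).1 e).1)
    · exact absurd e h1
    · exact absurd e h2
    · exact ⟨1, by norm_num, h.far_unique e (hσ x)⟩
    · refine ⟨3, by norm_num, ?_⟩
      rw [h.far_unique (swap_eq_of_eq h.toIsReduced e) (hσ y)]
      exact (h.iterate_four hσ y).symm
  · rintro ⟨k, hk, rfl⟩
    interval_cases k
    · simp [(h.sch.diag x x).2 rfl]
    · simp [hσ x]
    · simp [h.iterate_mate hσ x]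
    · simp [h3]

theorem iterate_congr (h : IsFarSymm A c) (hσ : ∀ x, c x (σ x) = (1, 3)) {x : V} {k l : ℕ}
    (hk : k < 4) (hl : l < 4) (e : σ^[k] x = σ^[l] x) : k = l := by
  have e3 := hσ (σ (σ (σ x)))
  rw [h.iterate_four hσ] at e3
  have e3 := swap_eq_of_eq h.toIsReduced e3
  have t : ∀ j < 4, c x (σ^[j] x) =
      if j = 0 then (0, 0) else if j = 1 then (1, 3) else if j = 2 then (2, 2) else (3, 1) := by
    intro j hj
    interval_cases j
    · exact (h.sch.diag x x).2 rfl
    · exact hσ x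
    · exact h.iterate_mate hσ x
    · exact e3
  have e' : c x (σ^[k] x) = c x (σ^[l] x) := by rw [e]
  rw [t k hk, t l hl] at e'
  clear t e
  interval_cases k <;> interval_cases l <;> simp at e' ⊢

theorem block_equiv (h : IsFarSymm A c) (hσ : ∀ x, c x (σ x) = (1, 3)) :
    Equivalence fun x y => c x y ≠ (1, 2) ∧ c x y ≠ (2, 1) where
  refl x := (h.block_iff hσ x x).2 ⟨0, by norm_num, rfl⟩
  symm := by
    rintro x y ⟨h1, h2⟩
    exact ⟨fun e => h2 (swap_eq_of_eq h.toIsReduced e), fun e => h1 (swap_eq_of_eq h.toIsReduced e)⟩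
  trans := by
    intro x y z h1 h2
    obtain ⟨k, hk, rfl⟩ := (h.block_iff hσ _ _).1 h1
    obtain ⟨l, hl, rfl⟩ := (h.block_iff hσ _ _).1 h2
    refine (h.block_iff hσ _ _).2 ?_
    rw [← Function.iterate_add_apply]
    by_cases hlk : l + k < 4
    · exact ⟨_, hlk, rfl⟩
    · refine ⟨l + k - 4, by omega, ?_⟩
      rw [← h.iterate_add_four hσ (l + k - 4), Nat.sub_add_cancel (by omega)]

theorem block_iterate (h : IsFarSymm A c) (hσ : ∀ x, c x (σ x) = (1, 3)) (x : V) (k : ℕ) :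
    c x (σ^[k] x) ≠ (1, 2) ∧ c x (σ^[k] x) ≠ (2, 1) := by
  induction k with
  | zero => exact (h.block_equiv hσ).refl _
  | succ k ih =>
    rw [Function.iterate_succ_apply']
    exact (h.block_equiv hσ).trans ih (by rw [hσ]; simp)

theorem iterate_out (h : IsFarSymm A c) (hσ : ∀ x, c x (σ x) = (1, 3)) {x y : V}
    (hb : ¬ (c x y ≠ (1, 2) ∧ c x y ≠ (2, 1))) : A (σ x) y ↔ A x y := by
  refine (h.out_iff (hσ x) ?_ ?_).symm
  · rintro (rfl | e)
    · exact hb ((h.block_equiv hσ).refl _)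
    · refine hb ?_
      rw [swap_eq_of_eq h.toIsReduced e]; simp
  · intro e
    refine hb ((h.block_equiv hσ).trans (y := σ x) (by rw [hσ]; simp) ?_)
    rcases e with rfl | e
    · exact (h.block_equiv hσ).refl _
    · rw [swap_eq_of_eq h.toIsReduced e]; simp

theorem block_arc (h : IsFarSymm A c) (hσ : ∀ x, c x (σ x) = (1, 3)) {x y x' y' : V}
    (hb : ¬ (c x y ≠ (1, 2) ∧ c x y ≠ (2, 1)))
    (hx : c x x' ≠ (1, 2) ∧ c x x' ≠ (2, 1)) (hy : c y y' ≠ (1, 2) ∧ c y y' ≠ (2, 1)) :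
    A x' y' ↔ A x y := by
  have eq := h.block_equiv hσ
  have adj : ∀ {u v}, ¬ (c u v ≠ (1, 2) ∧ c u v ≠ (2, 1)) → (A u v ↔ ¬ A v u) := by
    intro u v huv
    have : A u v ∨ A v u := (h.adj_iff u v).2 fun e => huv (by
      rcases (h.same_iff u v).1 e with e | e <;> simp [e])
    exact ⟨h.asymm, this.resolve_right⟩
  have left : ∀ {u v w}, ¬ (c u v ≠ (1, 2) ∧ c u v ≠ (2, 1)) →
      (c u w ≠ (1, 2) ∧ c u w ≠ (2, 1)) → (A w v ↔ A u v) := by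
    intro u v w huv huw
    obtain ⟨k, -, rfl⟩ := (h.block_iff hσ _ _).1 huw
    clear huw
    induction k with
    | zero => rfl
    | succ k ih =>
      rw [Function.iterate_succ_apply', ← ih]
      exact h.iterate_out hσ fun e => huv (eq.trans (h.block_iterate hσ u k) e)
  have hb1 : ¬ (c x' y ≠ (1, 2) ∧ c x' y ≠ (2, 1)) := fun e => hb (eq.trans hx e)
  have hb2 : ¬ (c x' y' ≠ (1, 2) ∧ c x' y' ≠ (2, 1)) := fun e => hb1 (eq.trans e (eq.symm hy))
  rw [← left hb hx, adj hb1, adj hb2, left (fun e => hb1 (eq.symm e)) hy]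

end IsFarSymm

theorem IsFarSymm.exists_iso_lexProd [Fintype V] {A : V → V → Prop} {c : V → V → ℕ × ℕ}
    (h : IsFarSymm A c) :
    ∃ (N : ℕ) (S : Fin N → Fin N → Prop), 1 ≤ N ∧ IsSemicomplete S ∧ IsWDRD S ∧ girth S = 3 ∧
      Iso A (lexProd S C4) := by
  choose σ hσ using h.exists_far_from
  obtain ⟨N, π, hsurj, hπ⟩ := exists_labelling _ (h.block_equiv hσ)
  choose ρ hρ using hsurj
  have πσ : ∀ k s, π (σ^[k] (ρ s)) = s := fun k s => by
    rw [(hπ _ _).2 ((h.block_equiv hσ).symm (h.block_iterate hσ (ρ s) k)), hρ]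
  have hne : ∀ {s t}, s ≠ t → ¬ (c (ρ s) (ρ t) ≠ (1, 2) ∧ c (ρ s) (ρ t) ≠ (2, 1)) := by
    intro s t hst e
    rw [← hπ, hρ, hρ] at e
    exact hst e
  let g : Fin N × ZMod 4 → V := fun p => σ^[p.2.val] (ρ p.1)
  have hg : Function.Bijective g := by
    constructor
    · rintro ⟨s, k⟩ ⟨t, l⟩ (e : σ^[k.val] (ρ s) = σ^[l.val] (ρ t))
      have hst : s = t := by rw [← πσ k.val s, e, πσ]
      subst hst
      rw [ZMod.val_injective 4 (h.iterate_congr hσ (ZMod.val_lt k) (ZMod.val_lt l) e)]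
    · intro x
      have : c (ρ (π x)) x ≠ (1, 2) ∧ c (ρ (π x)) x ≠ (2, 1) := by rw [← hπ, hρ]
      obtain ⟨k, hk, e⟩ := (h.block_iff hσ _ _).1 this
      refine ⟨(π x, (k : ZMod 4)), ?_⟩
      simp only [g]
      rw [ZMod.val_natCast, Nat.mod_eq_of_lt hk, ← e]
  have hfib : ∀ s, {x | π x = s}.ncard = 4 := by
    intro s
    have : {x | π x = s} = (fun k : ZMod 4 => g (s, k)) '' Set.univ := by
      ext x
      simp only [Set.mem_ofPred_eq, Set.image_univ, Set.mem_range]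
      constructor
      · rintro rfl
        obtain ⟨⟨t, k⟩, rfl⟩ := hg.2 x
        exact ⟨k, by simp only [g, πσ]⟩
      · rintro ⟨k, rfl⟩
        exact πσ _ _
    rw [this, Set.ncard_image_of_injective _ fun k l e => (Prod.ext_iff.1 (hg.1 e)).2,
      Set.ncard_univ, Nat.card_eq_fintype_card, ZMod.card]
  have harc : ∀ {x y}, π x ≠ π y → (A x y ↔ A (ρ (π x)) (ρ (π y))) := by
    intro x y hxy
    refine h.block_arc hσ (hne hxy) ?_ ?_ <;> rw [← hπ, hρ]
  have hcol : ∀ {x y}, ¬ (c x y ≠ (1, 2) ∧ c x y ≠ (2, 1)) → A x y → c x y = (1, 2) := by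
    intro x y hb hxy
    rw [← h.arc] at hxy
    by_contra e
    exact hb ⟨e, fun e' => by rw [e'] at hxy; simp at hxy⟩
  have hadj : ∀ {x y}, ¬ (c x y ≠ (1, 2) ∧ c x y ≠ (2, 1)) → A x y ∨ A y x := by
    intro x y hb
    exact (h.adj_iff x y).2 fun e => hb (by
      rcases (h.same_iff x y).1 e with e | e <;> simp [e])
  have hsch := h.sch.quotient hρ (by norm_num) hfib
    (fun x y x' y' e k => by rw [hπ] at k ⊢; rwa [← e])
    (fun x y hxy => by
      have h1 : ¬ (c x y ≠ (1, 2) ∧ c x y ≠ (2, 1)) := by rwa [← hπ]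
      rcases hadj h1 with e | e
      · rw [hcol h1 e, hcol (hne hxy) ((harc hxy).1 e)]
      · have e' := (harc (Ne.symm hxy)).1 e
        rw [h.sch.swap y x, h.sch.swap (ρ (π y)),
          hcol (fun k => h1 ((h.block_equiv hσ).symm k)) e, hcol (hne (Ne.symm hxy)) e'])
  have hirr : ∀ s, ¬ A (ρ s) (ρ s) := fun s => h.irrefl _
  have hss : ∀ s t, s ≠ t → A (ρ s) (ρ t) ∨ A (ρ t) (ρ s) := fun s t hst => hadj (hne hst)
  have hback : ∀ s t, A (ρ s) (ρ t) → ∃ u, A (ρ t) (ρ u) ∧ A (ρ u) (ρ s) := by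
    intro s t hst
    have hst' : s ≠ t := by rintro rfl; exact hirr s hst
    obtain ⟨z, hz, hz'⟩ := h.near _ _ (hcol (hne hst') hst)
    have key : ∀ {u z}, A (ρ u) z → π z ≠ u → A (ρ u) (ρ (π z)) := by
      intro u z huz hu
      have := (harc (x := ρ u) (y := z) (by rw [hρ]; exact hu.symm)).1 huz
      rwa [hρ] at this
    have key' : ∀ {u z}, A z (ρ u) → π z ≠ u → A (ρ (π z)) (ρ u) := by
      intro u z huz hu
      have := (harc (x := z) (y := ρ u) (by rw [hρ]; exact hu)).1 huz
      rwa [hρ] at this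
    have h1 : π z ≠ s := by
      intro e
      refine h.asymm hst ?_
      rw [← e]
      exact key hz (by rw [e]; exact hst')
    have h2 : π z ≠ t := by
      intro e
      refine h.asymm hst ?_
      rw [← e]
      exact key' hz' h1
    exact ⟨π z, key hz h2, key' hz' h1⟩
  have hex : ∃ s t, A (ρ s) (ρ t) := by
    obtain ⟨x, y, e⟩ := h.exists_near
    refine ⟨π x, π y, (harc fun k => ?_).1 ((h.arc x y).1 (by rw [e]))⟩
    rw [hπ] at k
    exact k.1 e
  have hS := isCWDRD_of_tournament (S := fun s t => A (ρ s) (ρ t)) hsch hirr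
    (fun s t e => h.asymm e) hss
    (fun s t e => hcol (hne fun k => hirr s (by rwa [← k] at e)) e) hback hex
  obtain ⟨s, t, hst⟩ := hex
  obtain ⟨u, htu, hus⟩ := hback s t hst
  refine ⟨N, fun s t => A (ρ s) (ρ t), s.pos, ⟨hirr, hss⟩, hS.1,
    girth_eq_three hirr (fun _ _ e => h.asymm e) ⟨s, t, u, hst, htu, hus⟩,
    (Equiv.ofBijective g hg).symm, fun x y => ?_⟩
  obtain ⟨⟨s, k⟩, rfl⟩ := hg.2 x
  obtain ⟨⟨t, l⟩, rfl⟩ := hg.2 y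
  rw [Equiv.ofBijective_symm_apply_apply, Equiv.ofBijective_symm_apply_apply]
  simp only [lexProd]
  by_cases hst : s = t
  · subst hst
    have h1 : A (g (s, k)) (g (s, l)) ↔ g (s, l) = g (s, k + 1) := by
      have h2 : g (s, k + 1) = σ (g (s, k)) := by
        simp only [g, ← Function.iterate_succ_apply']
        rw [ZMod.val_add, show (1 : ZMod 4).val = 1 from rfl]
        have := ZMod.val_lt k
        by_cases hk : k.val + 1 < 4
        · rw [Nat.mod_eq_of_lt hk]
        · rw [show k.val = 3 by omega]
          exact (h.iterate_four hσ _).symm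
      rw [h2]
      constructor
      · intro e
        have hb : c (g (s, k)) (g (s, l)) ≠ (1, 2) ∧ c (g (s, k)) (g (s, l)) ≠ (2, 1) := by
          rw [← hπ, πσ, πσ]
        rcases h.arc_colors e with e' | e' | e'
        · exact absurd ((h.edge_iff _ _).1 e').2 (h.asymm e)
        · exact absurd e' hb.1
        · exact h.far_unique e' (hσ _)
      · intro e
        rw [e, ← h.arc, hσ]
    rw [h1, hg.1.eq_iff]
    simp only [Prod.mk.injEq, true_and, hirr, false_or, C4]
  · have := harc (x := g (s, k)) (y := g (t, l)) (by simpa only [g, πσ] using hst)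
    rw [this]
    simp only [g, πσ, hst, false_and, or_false]

/-- The relation of having two-way distance `(1,3)` or `(2,1)`. -/
def mixed (c : V → V → ℕ × ℕ) (x y : V) : Prop := c x y = (1, 3) ∨ c x y = (2, 1)

/-- Every partite set containing a vertex at two-way distance `(1,3)` from `x` consists of
vertices at two-way distance `(1,3)` or `(2,1)` from `x`, and both occur. -/
structure IsFarMixed (A : V → V → Prop) (c : V → V → ℕ × ℕ) : Prop extends IsReduced A c where
  profile : ∀ x y, c x y = (1, 3) → ∀ w, same c w y → mixed c x w
  profile_back : ∀ x y, c x y = (1, 3) → ∃ w, same c w y ∧ c x w = (2, 1)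
  exists_far : ∃ x y, c x y = (1, 3)

/-- If the pairs at two-way distance `(1,3)` and `(1,2)` both occur, then one of the two kinds of
profile occurs uniformly. -/
theorem IsReduced.farSymm_or_farMixed [Fintype V] {A : V → V → Prop} {c : V → V → ℕ × ℕ}
    (h : IsReduced A c) (hfar : ∃ x y, c x y = (1, 3)) (hnear : ∃ x y, c x y = (1, 2)) :
    IsFarSymm A c ∨ IsFarMixed A c := by
  obtain ⟨x, y, e⟩ := hfar
  rcases h.far_profile e with h1 | ⟨h1, h2⟩
  · refine Or.inl ⟨h, fun x' y' e' K => ?_, ⟨x, y, e⟩, hnear⟩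
    rw [h.partCount_reg K (e'.trans e.symm), h.partCount_reg _ (e'.trans e.symm), h1]
  · refine Or.inr ⟨h, fun x' y' e' => ?_, fun x' y' e' => ?_, ⟨x, y, e⟩⟩
    · have h3 : partCount c (fun i => ¬ (i = (1, 3) ∨ i = (2, 1))) x y = 0 :=
        h.partCount_eq_zero.2 fun w hw => not_not.2 (h1 w hw)
      rw [h.partCount_reg _ (e.trans e'.symm)] at h3
      exact fun w hw => not_not.1 (h.partCount_eq_zero.1 h3 w hw)
    · obtain ⟨w, hw, hw'⟩ := h2
      have h3 : 0 < partCount c (fun i => i = (2, 1)) x y := h.partCount_pos.2 ⟨w, hw', hw⟩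
      rw [h.partCount_reg _ (e.trans e'.symm)] at h3
      obtain ⟨w, hw, hw'⟩ := h.partCount_pos.1 h3
      exact ⟨w, hw', hw⟩

namespace IsFarMixed

variable {A : V → V → Prop} {c : V → V → ℕ × ℕ}

theorem not_mixed_swap (h : IsFarMixed A c) {x y : V} (hxy : mixed c x y) : ¬ mixed c y x := by
  intro hyx
  unfold mixed at *
  rw [h.sch.swap x y] at hyx
  rcases hxy with e | e <;> simp [e] at hyx

theorem not_mixed_of_same (h : IsFarMixed A c) {x y : V} (hxy : same c x y) : ¬ mixed c x y := by
  intro e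
  unfold mixed at e
  rcases (h.same_iff x y).1 hxy with e' | e' <;> simp [e'] at e

variable [Fintype V]

theorem mixed_right (h : IsFarMixed A c) {x y w : V} (hxy : mixed c x y) (hw : same c w y) :
    mixed c x w := by
  rcases hxy with hxy | hxy
  · exact h.profile x y hxy w hw
  · obtain ⟨x₀, y₀, e⟩ := h.exists_far
    obtain ⟨w₀, hs, hw₀⟩ := h.profile_back _ _ e
    have h3 : partCount c (fun i => ¬ (i = (1, 3) ∨ i = (2, 1))) x₀ w₀ = 0 :=
      h.partCount_eq_zero.2 fun w hw =>
        not_not.2 (h.profile x₀ y₀ e w (h.same_equiv.trans hw hs))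
    rw [h.partCount_reg _ (hw₀.trans hxy.symm)] at h3
    exact not_not.1 (h.partCount_eq_zero.1 h3 w hw)

theorem mixed_left (h : IsFarMixed A c) {x y w : V} (hxy : mixed c x y) (hw : same c x w) :
    mixed c w y := by
  have h3 : partCount c (fun i => ¬ (i = (1, 3) ∨ i = (2, 1))) x y = 0 :=
    h.partCount_eq_zero.2 fun v hv => not_not.2 (h.mixed_right hxy hv)
  rw [h.partCount_left _ hw] at h3
  exact not_not.1 (h.partCount_eq_zero.1 h3 y (h.same_equiv.refl y))

theorem exists_far_of_mixed (h : IsFarMixed A c) {x y : V} (hxy : mixed c x y) :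
    ∃ w, same c w y ∧ c x w = (1, 3) := by
  rcases hxy with hxy | hxy
  · exact ⟨y, h.same_equiv.refl y, hxy⟩
  · obtain ⟨x₀, y₀, e⟩ := h.exists_far
    obtain ⟨w₀, hs, hw₀⟩ := h.profile_back _ _ e
    have h3 : 0 < partCount c (fun i => i = (1, 3)) x₀ w₀ :=
      h.partCount_pos.2 ⟨y₀, e, h.same_equiv.symm hs⟩
    rw [h.partCount_reg _ (hw₀.trans hxy.symm)] at h3
    obtain ⟨w, hw, hw'⟩ := h.partCount_pos.1 h3
    exact ⟨w, hw', hw⟩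

/-- In a partite set in which `x` has a mixed profile from outside, `x` has both out- and
in-neighbours. -/
theorem exists_in_of_mixed_swap (h : IsFarMixed A c) {x y : V} (hxy : mixed c y x) :
    ∃ w, same c w y ∧ c x w = (3, 1) := by
  obtain ⟨w, hw, e⟩ := h.exists_far_of_mixed hxy
  have h3 : 0 < partCount c (fun i => i = (1, 3)) y x := h.partCount_pos.2 ⟨w, e, hw⟩
  rw [h.partCount_singleton_swap] at h3
  obtain ⟨v, hv, hv'⟩ := h.partCount_pos.1 h3
  exact ⟨v, hv', hv⟩

theorem exists_far_to (h : IsFarMixed A c) (y : V) : ∃ x, c x y = (1, 3) := by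
  obtain ⟨x₀, y₀, e⟩ := h.exists_far
  have h1 : 0 < cval c (fun i => i = (3, 1)) y₀ :=
    ncard_pos_iff.2 ⟨x₀, swap_eq_of_eq h.toIsReduced e⟩
  rw [h.sch.cval_reg _ y₀ y] at h1
  obtain ⟨x, hx⟩ := ncard_pos_iff.1 h1
  exact ⟨x, swap_eq_of_eq h.toIsReduced hx⟩

theorem asymm (h : IsFarMixed A c) {y w : V} (h1 : A y w) : ¬ A w y := by
  intro h2
  have hyw := (h.edge_iff y w).2 ⟨h1, h2⟩
  have nm1 : ¬ mixed c y w := by simp [mixed, hyw]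
  have nm2 : ¬ mixed c w y := by simp [mixed, (h.edge_iff w y).2 ⟨h2, h1⟩]
  have hall : ∀ w', same c w' w → A y w' := by
    intro w' hw'
    have n1 : ¬ mixed c y w' := fun e => nm1 (h.mixed_right e (h.same_equiv.symm hw'))
    have n2 : ¬ mixed c w' y := fun e => nm2 (h.mixed_left e hw')
    unfold mixed at n1 n2
    rw [h.sch.swap y w'] at n2
    have n3 : ¬ same c y w' := fun e => h.not_same_of_arc h1 (h.same_equiv.trans e hw')
    rw [h.same_iff] at n3
    rw [← h.arc]
    rcases h.colors y w' with e | e | e | e | e | e | e <;> simp [e] at n1 n2 n3 ⊢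
  obtain ⟨x, hx⟩ := h.exists_far_to y
  have hback : ∀ w', same c w' w → ¬ A w' x := fun w' hw' => h.far x y hx w' (hall w' hw')
  have hxw : ¬ same c x w := fun e => nm2 (h.mixed_left (Or.inl hx) e)
  have hAx : A x w := ((h.adj_iff x w).2 hxw).resolve_right (hback w (h.same_equiv.refl w))
  rcases h.arc_colors hAx with e | e | e
  · exact hback w (h.same_equiv.refl w) ((h.edge_iff x w).1 e).2
  · obtain ⟨v, hv, hv'⟩ := h.exists_in_of_mixed_swap (x := x) (y := w)
      (Or.inr (swap_eq_of_eq h.toIsReduced e))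
    exact hback v hv ((h.arc' x v).1 (by rw [hv']))
  · obtain ⟨v, hv, hv'⟩ := h.profile_back x w e
    exact hback v hv ((h.arc' x v).1 (by rw [hv']))

theorem mixed_or (h : IsFarMixed A c) {x y : V} (hxy : ¬ same c x y) :
    mixed c x y ∨ mixed c y x := by
  unfold mixed
  rw [h.same_iff] at hxy
  rw [h.sch.swap x y]
  rcases h.colors x y with e | e | e | e | e | e | e <;> simp [e] at hxy ⊢
  exact h.asymm ((h.edge_iff x y).1 e).1 ((h.edge_iff x y).1 e).2

theorem partCount_reg_mixed (h : IsFarMixed A c) (K : ℕ × ℕ → Prop) {x y x' y' : V}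
    (hxy : mixed c x y) (hxy' : mixed c x' y') : partCount c K x y = partCount c K x' y' := by
  obtain ⟨w, hw, e⟩ := h.exists_far_of_mixed hxy
  obtain ⟨w', hw', e'⟩ := h.exists_far_of_mixed hxy'
  rw [← h.partCount_right K hw, ← h.partCount_right K hw', h.partCount_reg K (e.trans e'.symm)]

theorem far_same (h : IsFarMixed A c) {x y y' : V} (hxy : c x y = (1, 3)) (hxy' : c x y' = (1, 3)) :
    same c y y' := by
  have key : ∀ {y y'}, c x y = (1, 3) → c x y' = (1, 3) → ¬ mixed c y y' := by
    intro y y' hy hy' hm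
    have hs : ¬ same c y y' := fun e => h.not_mixed_of_same e hm
    have hle : partCount c (fun i => i.1 = 1) y' y ≤ partCount c (fun i => i.1 = 1) x y := by
      refine ncard_mono_set fun w hw =>
        ⟨(h.arc x w).2 (h.far_out hy' ((h.arc y' w).1 hw.1) fun e => ?_), hw.2⟩
      exact h.not_same_of_arc (h.far_arc hy) (h.same_equiv.trans (h.same_equiv.symm e) hw.2)
    rw [h.partCount_swap, h.partCount_reg_mixed _ hm (Or.inl hy)] at hle
    have H : ∀ u v, c u v = (1, 3) →
        partCount c (fun i => i.1 = 1) v u ≤ partCount c (fun i => i.1 = 1) u v := by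
      intro u v huv
      rw [h.partCount_swap, h.partCount_reg_mixed _ (Or.inl huv) (Or.inl hy),
        h.partCount_reg_mixed _ (Or.inl huv) (Or.inl hy)]
      exact hle
    obtain ⟨h1, h2⟩ := h.far_far hy hy' H hs
    exact h.asymm h1 h2
  by_contra hs
  exact (h.mixed_or hs).elim (key hxy hxy') (key hxy' hxy)

theorem mixed_same (h : IsFarMixed A c) {x y y' : V} (hxy : mixed c x y) (hxy' : mixed c x y') :
    same c y y' := by
  obtain ⟨w, hw, e⟩ := h.exists_far_of_mixed hxy
  obtain ⟨w', hw', e'⟩ := h.exists_far_of_mixed hxy'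
  exact h.same_equiv.trans (h.same_equiv.symm hw) (h.same_equiv.trans (h.far_same e e') hw')

theorem far_far_near (h : IsFarMixed A c) {x y z : V} (hxy : c x y = (1, 3)) (hyz : c y z = (1, 3)) :
    c x z = (1, 2) := by
  have hs : ¬ same c x z := fun e =>
    h.not_mixed_swap (Or.inl hxy) (h.mixed_right (Or.inl hyz) e)
  rcases h.mixed_or hs with e | e
  · exact absurd (h.mixed_same (Or.inl hxy) e) (h.not_same_of_arc (h.far_arc hyz))
  · rcases e with e | e
    · exact absurd (h.far_arc e) (h.far x y hxy z (h.far_arc hyz))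
    · exact swap_eq_of_eq h.toIsReduced e

end IsFarMixed

namespace IsFarMixed

variable [Fintype V] {A : V → V → Prop} {c : V → V → ℕ × ℕ}

theorem exists_far_from (h : IsFarMixed A c) (x : V) : ∃ y, c x y = (1, 3) := by
  obtain ⟨x₀, y₀, e⟩ := h.exists_far
  have h1 : 0 < cval c (fun i => i = (1, 3)) x₀ := ncard_pos_iff.2 ⟨y₀, e⟩
  rw [h.sch.cval_reg _ x₀ x] at h1
  exact ncard_pos_iff.1 h1

theorem card_far_same (h : IsFarMixed A c) {x u : V} (hu : c x u = (1, 3)) :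
    {z | c z u = (1, 3) ∧ same c z x}.ncard = {y | c x y = (1, 3)}.ncard := by
  have h1 := h.partCount_singleton_swap (1, 3) x u
  unfold partCount at h1
  rw [ncard_congr_set (q := fun y => c x y = (1, 3)) fun y =>
    ⟨fun e => e.1, fun e => ⟨e, h.far_same e hu⟩⟩] at h1
  rw [h1]
  refine ncard_congr_set fun z => and_congr_left fun _ => ?_
  rw [h.sch.swap u z, Prod.swap_eq_iff_eq_swap]

theorem mate_card (h : IsFarMixed A c) (x : V) :
    {y | c x y = (2, 2)}.ncard + 1 =
      {y | c x y = (1, 3)}.ncard + {y | c x y = (2, 1)}.ncard := by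
  obtain ⟨y, hxy⟩ := h.exists_far_from x
  have h1 : {w | c x w = (1, 3) ∨ c x w = (2, 1)}.ncard =
      {y | c x y = (1, 3)}.ncard + {y | c x y = (2, 1)}.ncard := by
    rw [← Set.ncard_union_eq]
    · rfl
    · rw [Set.disjoint_left]
      intro z (hz : c x z = _) (hz' : c x z = _)
      rw [hz] at hz'
      simp at hz'
  have h2 : {w | c x w = (1, 3) ∨ c x w = (2, 1)} = insert y {w | c y w = (2, 2)} := by
    ext w
    constructor
    · intro hw
      rcases h.mixed_same hw (Or.inl hxy) with e | e
      · exact Or.inl e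
      · exact Or.inr (swap_eq_of_eq h.toIsReduced e)
    · rintro (rfl | e)
      · exact Or.inl hxy
      · exact h.mixed_right (Or.inl hxy) (Or.inr (swap_eq_of_eq h.toIsReduced e))
  rw [← h1, h2, Set.ncard_insert_of_notMem]
  · exact congrArg (· + 1) (h.sch.cval_reg (· = (2, 2)) x y)
  · intro (e : c y y = _)
    rw [(h.sch.diag y y).2 rfl] at e
    simp at e

theorem card_eq_one (h : IsFarMixed A c) (x : V) :
    {y | c x y = (1, 3)}.ncard = 1 ∧ {y | c x y = (1, 2)}.ncard = 1 ∧
      {y | c x y = (2, 1)}.ncard = 1 ∧ {y | c x y = (2, 2)}.ncard = 1 := by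
  have hsw := fun {x y : V} {a b : ℕ} => swap_eq_of_eq (x := x) (y := y) (a := a) (b := b)
    h.toIsReduced
  obtain ⟨y, hxy⟩ := h.exists_far_from x
  have hk := h.mate_card x
  obtain ⟨w, hw, hxw⟩ := h.profile_back x y hxy
  have hw' : c w y = (2, 2) := by
    rcases hw with rfl | e
    · rw [hxy] at hxw; simp at hxw
    · exact e
  obtain ⟨z, hyz⟩ := h.exists_far_from y
  set a := {y | c x y = (1, 3)}.ncard with ha
  set b := {y | c x y = (2, 1)}.ncard with hb
  set k := {y | c x y = (2, 2)}.ncard with hkd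
  have ha' : ∀ z, {y | c z y = (1, 3)}.ncard = a := fun z => h.sch.cval_reg (· = (1, 3)) z x
  have hk' : ∀ z, {y | c z y = (2, 2)}.ncard = k := fun z => h.sch.cval_reg (· = (2, 2)) z x
  have hb' : {y | c x y = (1, 2)}.ncard = b := by
    rw [hb]
    refine Eq.trans ?_ (h.sch.cval_swap (· = (2, 1)) x)
    exact ncard_congr_set fun y => ⟨fun e => congrArg Prod.swap e, fun e => Prod.swap_injective e⟩
  have ha0 : 0 < a := ncard_pos_iff.2 ⟨y, hxy⟩
  have hb0 : 0 < b := ncard_pos_iff.2 ⟨w, hxw⟩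
  obtain ⟨x', hxx'⟩ : ∃ x', c x x' = (2, 2) := ncard_pos_iff.1 (show 0 < k by omega)
  set l := {u | c x u = (1, 3) ∧ c u x' = (3, 1)}.ncard with hl
  set m := {u | c x u = (1, 3) ∧ c u z = (1, 3)}.ncard with hm
  have e1 : k * l = a * (a - 1) := by
    refine double_count (p := fun z => c x z = (2, 2)) (q := fun u => c x u = (1, 3))
      (R := fun z u => c u z = (3, 1)) (fun z hz => ?_) (fun u hu => ?_)
    · exact h.sch.reg _ _ _ _ _ _ (hz.trans hxx'.symm)
    · have h1 := ncard_split (fun z => c z u = (1, 3) ∧ same c z x) (fun z => z = x)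
      have h2 : {z | (c z u = (1, 3) ∧ same c z x) ∧ z = x}.ncard = 1 := by
        rw [ncard_congr_set (q := fun z => z = x)]
        · exact Set.ncard_singleton x
        · exact fun z => ⟨fun e => e.2, by
            rintro rfl; exact ⟨⟨hu, h.same_equiv.refl z⟩, rfl⟩⟩
      have h3 : {z | c x z = (2, 2) ∧ c u z = (3, 1)}.ncard =
          {z | (c z u = (1, 3) ∧ same c z x) ∧ ¬ z = x}.ncard := by
        refine ncard_congr_set fun z =>
          ⟨fun e => ⟨⟨hsw e.2, Or.inr (hsw e.1)⟩, ?_⟩, fun e => ⟨?_, hsw e.1.1⟩⟩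
        · rintro rfl
          rw [(h.sch.diag z z).2 rfl] at e
          simp at e
        · exact hsw (e.1.2.resolve_left e.2)
      rw [h3]
      have := h.card_far_same hu
      omega
  have e2 : b * m = a * a := by
    rw [← hb']
    refine double_count (p := fun z => c x z = (1, 2)) (q := fun u => c x u = (1, 3))
      (R := fun z u => c u z = (1, 3)) (fun v hv => ?_) (fun u hu => ?_)
    · exact h.sch.reg _ _ _ _ _ _ (hv.trans (h.far_far_near hxy hyz).symm)
    · rw [← ha' u]
      exact ncard_congr_set fun v => ⟨fun e => e.2, fun e => ⟨h.far_far_near hu e, e⟩⟩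
  have e3 : a + (a - 1) * l = a * m := by
    classical
    have hs := sum_count_comm (p := fun u => c x u = (1, 3)) (q := fun v => c y v = (1, 3))
      (R := fun u v => c u v = (1, 3))
    have hr : ∀ v ∈ {v | c y v = (1, 3)}.toFinite.toFinset,
        {u | c x u = (1, 3) ∧ c u v = (1, 3)}.ncard = m := by
      intro v hv
      have hv : c y v = (1, 3) := by simpa using hv
      exact h.sch.reg _ _ _ _ _ _ ((h.far_far_near hxy hv).trans (h.far_far_near hxy hyz).symm)
    rw [Finset.sum_congr rfl hr, Finset.sum_const, smul_eq_mul,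
      ← Set.ncard_eq_toFinset_card _, ha'] at hs
    rw [← hs, ← Finset.add_sum_erase _ _ (a := y) (by simpa using hxy)]
    congr 1
    · exact (ha' y).symm.trans (ncard_congr_set fun v => ⟨fun e => ⟨e, e⟩, fun e => e.1⟩)
    · have hr' : ∀ u ∈ {u | c x u = (1, 3)}.toFinite.toFinset.erase y,
          {v | c y v = (1, 3) ∧ c u v = (1, 3)}.ncard = l := by
        intro u hu
        simp only [Finset.mem_erase, Set.Finite.mem_toFinset, Set.mem_ofPred_eq] at hu
        have hyu : c y u = (2, 2) := hsw ((h.far_same hu.2 hxy).resolve_left hu.1)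
        rw [hl, ← cset_eq_cset h.sch _ _ (hyu.trans hxx'.symm)]
        exact ncard_congr_set fun v => and_congr_right fun _ => ⟨hsw, hsw⟩
      rw [Finset.sum_congr rfl hr', Finset.sum_const, smul_eq_mul,
        Finset.card_erase_of_mem (by simpa using hxy), ← Set.ncard_eq_toFinset_card _]
  obtain ⟨n, hn⟩ : ∃ n, a = n + 1 := ⟨a - 1, by omega⟩
  rw [hn, Nat.add_sub_cancel] at e1 e3
  have hd : n + 1 ∣ l := by
    have h1 : n + 1 ∣ n * l := (Nat.dvd_add_right (dvd_refl _)).1 ⟨m, e3⟩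
    exact Nat.Coprime.dvd_of_dvd_mul_left (by simp) h1
  obtain ⟨l', hl'⟩ := hd
  have e4 : k * l' = n := by
    rw [hl'] at e1
    exact Nat.eq_of_mul_eq_mul_left (show 0 < n + 1 by omega) (by rw [← e1]; ring)
  have hn0 : n = 0 := by
    rcases Nat.eq_zero_or_pos l' with e | e
    · rw [← e4, e, mul_zero]
    · have := Nat.le_mul_of_pos_right k e
      omega
  have hb1 : b = 1 := Nat.eq_one_of_mul_eq_one_right (by rw [e2, hn, hn0])
  omega

end IsFarMixed

theorem eq_of_card_eq_one {p : V → Prop} (hp : {x | p x}.ncard = 1) {x y : V} (hx : p x)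
    (hy : p y) : x = y := by
  obtain ⟨a, ha⟩ := Set.ncard_eq_one.1 hp
  have h1 : x ∈ {x | p x} := hx
  have h2 : y ∈ {x | p x} := hy
  rw [ha] at h1 h2
  exact h1.trans h2.symm

namespace IsFarMixed

variable [Fintype V] {A : V → V → Prop} {c : V → V → ℕ × ℕ}

theorem near_far_mate (h : IsFarMixed A c) {x y z : V} (hxy : c x y = (1, 2))
    (hyz : c y z = (1, 3)) : c x z = (2, 2) := by
  have hyx := swap_eq_of_eq h.toIsReduced hxy
  refine (h.mixed_same (Or.inr hyx) (Or.inl hyz)).resolve_left ?_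
  rintro rfl
  rw [hyx] at hyz
  simp at hyz

theorem iso_cay6 [Nonempty V] (h : IsFarMixed A c) : Iso A Cay6 := by
  have hsw := fun {x y : V} {a b : ℕ} => swap_eq_of_eq (x := x) (y := y) (a := a) (b := b)
    h.toIsReduced
  choose σ h1 using h.exists_far_from
  have h2 : ∀ x, c x (σ (σ x)) = (1, 2) := fun x => h.far_far_near (h1 x) (h1 _)
  have h3 : ∀ x, c x (σ (σ (σ x))) = (2, 2) := fun x => h.near_far_mate (h2 x) (h1 _)
  have h6 : ∀ x, σ (σ (σ (σ (σ (σ x))))) = x := fun x =>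
    eq_of_card_eq_one (h.card_eq_one (σ (σ (σ x)))).2.2.2 (h3 _) (hsw (h3 x))
  have h4 : ∀ x, c x (σ (σ (σ (σ x)))) = (2, 1) := fun x => by
    have := h2 (σ (σ (σ (σ x))))
    rw [h6] at this
    exact hsw this
  have h5 : ∀ x, c x (σ (σ (σ (σ (σ x))))) = (3, 1) := fun x => by
    have := h1 (σ (σ (σ (σ (σ x)))))
    rw [h6] at this
    exact hsw this
  obtain ⟨x⟩ := ‹Nonempty V›
  let f : ZMod 6 → V :=
    ![x, σ x, σ (σ x), σ (σ (σ x)), σ (σ (σ (σ x))), σ (σ (σ (σ (σ x))))]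
  have hf : ∀ i, f (i + 1) = σ (f i) := by
    intro i
    fin_cases i
    · rfl
    · rfl
    · rfl
    · rfl
    · rfl
    · exact (h6 x).symm
  have hc : ∀ i d, c (f i) (f (i + d)) =
      (![(0, 0), (1, 3), (1, 2), (2, 2), (2, 1), (3, 1)] : Fin 6 → ℕ × ℕ) d := by
    intro i d
    have e2 : f (i + 2) = σ (σ (f i)) := by
      rw [show i + 2 = i + 1 + 1 by ring, hf, hf]
    have e3 : f (i + 3) = σ (σ (σ (f i))) := by
      rw [show i + 3 = i + 2 + 1 by ring, hf, e2]
    have e4 : f (i + 4) = σ (σ (σ (σ (f i)))) := by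
      rw [show i + 4 = i + 3 + 1 by ring, hf, e3]
    have e5 : f (i + 5) = σ (σ (σ (σ (σ (f i))))) := by
      rw [show i + 5 = i + 4 + 1 by ring, hf, e4]
    fin_cases d
    · exact (h.sch.diag _ _).2 (congrArg f (add_zero i).symm)
    · exact (congrArg _ (hf i)).trans (h1 _)
    · exact (congrArg _ e2).trans (h2 _)
    · exact (congrArg _ e3).trans (h3 _)
    · exact (congrArg _ e4).trans (h4 _)
    · exact (congrArg _ e5).trans (h5 _)
  have hfb : Function.Bijective f := by
    refine ⟨fun i j hij => ?_, fun z => ?_⟩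
    · have := hc i (j - i)
      rw [add_sub_cancel, (h.sch.diag _ _).2 hij] at this
      generalize hd : j - i = d at this
      have hd0 : d = 0 := by
        fin_cases d <;> first | rfl | (exfalso; revert this; decide)
      exact (sub_eq_zero.1 (hd.trans hd0)).symm
    · rcases h.colors x z with e | e | e | e | e | e | e
      · exact ⟨0, (h.sch.diag _ _).1 e⟩
      · exact ⟨3, eq_of_card_eq_one (h.card_eq_one x).2.2.2 (h3 x) e⟩
      · exact absurd ((h.edge_iff x z).1 e).2 (h.asymm ((h.edge_iff x z).1 e).1)
      · exact ⟨2, eq_of_card_eq_one (h.card_eq_one x).2.1 (h2 x) e⟩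
      · exact ⟨4, eq_of_card_eq_one (h.card_eq_one x).2.2.1 (h4 x) e⟩
      · exact ⟨1, eq_of_card_eq_one (h.card_eq_one x).1 (h1 x) e⟩
      · refine ⟨5, ?_⟩
        have hx := eq_of_card_eq_one (h.card_eq_one z).1 (h1 z) (hsw e)
        change σ (σ (σ (σ (σ x)))) = z
        rw [← hx, h6]
  refine ⟨(Equiv.ofBijective f hfb).symm, fun y z => ?_⟩
  obtain ⟨i, rfl⟩ := hfb.2 y
  obtain ⟨j, rfl⟩ := hfb.2 z
  rw [Equiv.ofBijective_symm_apply_apply, Equiv.ofBijective_symm_apply_apply, ← h.arc]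
  have := hc i (j - i)
  rw [add_sub_cancel] at this
  rw [this, Cay6]
  generalize j - i = d
  revert d
  decide

end IsFarMixed

/-- All arcs without an opposite arc have the same two-way distance `s`. -/
structure IsUniform (A : V → V → Prop) (c : V → V → ℕ × ℕ) (s : ℕ × ℕ) : Prop
    extends IsReduced A c where
  fst : s.1 = 1
  snd : s.2 ≠ 1
  uniform : ∀ x y, A x y → ¬ A y x → c x y = s

namespace IsUniform

variable {A : V → V → Prop} {c : V → V → ℕ × ℕ} {s : ℕ × ℕ}

theorem eq_iff (h : IsUniform A c s) (x y : V) : c x y = s ↔ A x y ∧ ¬ A y x := by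
  refine ⟨fun e => ?_, fun e => h.uniform x y e.1 e.2⟩
  rw [← h.arc, ← h.arc', e]
  exact ⟨h.fst, h.snd⟩

theorem swap_eq_iff (h : IsUniform A c s) (x y : V) : c x y = s.swap ↔ c y x = s := by
  rw [h.sch.swap x y, Prod.swap_eq_iff_eq_swap]

theorem cases (h : IsUniform A c s) (x y : V) :
    c x y = (0, 0) ∨ c x y = (2, 2) ∨ c x y = (1, 1) ∨ c x y = s ∨ c x y = s.swap := by
  by_cases h1 : A x y <;> by_cases h2 : A y x
  · exact Or.inr (Or.inr (Or.inl ((h.edge_iff x y).2 ⟨h1, h2⟩)))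
  · exact Or.inr (Or.inr (Or.inr (Or.inl (h.uniform x y h1 h2))))
  · exact Or.inr (Or.inr (Or.inr (Or.inr ((h.swap_eq_iff x y).2 (h.uniform y x h2 h1)))))
  · have h3 : same c x y := by
      by_contra e
      exact ((h.adj_iff x y).2 e).elim h1 h2
    rcases (h.same_iff x y).1 h3 with e | e
    · exact Or.inl e
    · exact Or.inr (Or.inl e)

theorem cases_of_not_same (h : IsUniform A c s) {x y : V} (hxy : ¬ same c x y) :
    c x y = (1, 1) ∨ c x y = s ∨ c x y = s.swap := by
  rw [h.same_iff, not_or] at hxy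
  exact ((h.cases x y).resolve_left hxy.1).resolve_left hxy.2

theorem ne_swap (h : IsUniform A c s) : s ≠ s.swap := fun e =>
  h.snd ((Prod.ext_iff.1 e).1.symm.trans h.fst)

theorem ne_edge (h : IsUniform A c s) : s ≠ (1, 1) := fun e => h.snd (Prod.ext_iff.1 e).2

theorem swap_ne_edge (h : IsUniform A c s) : s.swap ≠ (1, 1) := fun e =>
  h.snd (Prod.ext_iff.1 e).1

theorem not_same (h : IsUniform A c s) {x y : V} (hxy : c x y = s) : ¬ same c x y :=
  h.not_same_of_arc ((h.eq_iff x y).1 hxy).1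

variable [Fintype V]

/-- The partite set of `y` is not uniformly coloured from `x`. -/
theorem exists_ne (h : IsUniform A c s) {x y : V} (hxy : c x y = s) :
    ∃ w, same c w y ∧ c x w ≠ s := by
  by_contra! hall
  have h1 : ∀ x' y', c x' y' = s → ∀ w, same c w y' → c x' w = s := by
    intro x' y' e w hw
    have h0 : partCount c (· ≠ s) x y = 0 :=
      h.partCount_eq_zero.2 fun w hw => not_not.2 (hall w hw)
    rw [h.partCount_reg _ (hxy.trans e.symm)] at h0
    exact not_not.1 (h.partCount_eq_zero.1 h0 w hw)
  have h2 : ∀ x' y', c y' x' = s → ∀ w, same c w y' → c w x' = s := by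
    intro x' y' e w hw
    have h0 : partCount c (· ≠ s) y' x' = 0 :=
      h.partCount_eq_zero.2 fun w hw => not_not.2 (h1 _ _ e w hw)
    rw [h.partCount_left _ (h.same_equiv.symm hw)] at h0
    exact not_not.1 (h.partCount_eq_zero.1 h0 x' (h.same_equiv.refl x'))
  have h3 : ∀ x' y' y'', same c y' y'' → c x' y' = c x' y'' ∨ same c x' y' := by
    intro x' y' y'' hs
    by_cases hxy' : same c x' y'
    · exact Or.inr hxy'
    left
    have hxy'' : ¬ same c x' y'' := fun e =>
      hxy' (h.same_equiv.trans e (h.same_equiv.symm hs))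
    rcases h.cases_of_not_same hxy' with e | e | e
    · rcases h.cases_of_not_same hxy'' with e' | e' | e'
      · rw [e, e']
      · rw [h1 _ _ e' _ hs, e']
      · rw [e', h.swap_eq_iff]
        rw [h.swap_eq_iff] at e'
        exact h2 _ _ e' _ hs
    · rw [e, h1 _ _ e _ (h.same_equiv.symm hs)]
    · rw [e, eq_comm, h.swap_eq_iff]
      rw [h.swap_eq_iff] at e
      exact h2 _ _ e _ (h.same_equiv.symm hs)
  obtain ⟨y₁, y₂, e⟩ := h.exists_nonadj
  have hs : same c y₁ y₂ := Or.inr e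
  have := h.twinfree y₁ y₂ fun z => by
    rcases h3 z y₁ y₂ hs with e | e
    · rw [← h.arc' z y₁, ← h.arc' z y₂, ← h.arc z y₁, ← h.arc z y₂, e]
      exact ⟨Iff.rfl, Iff.rfl⟩
    · have e1 := (h.adj_iff z y₁).not.2 (not_not.2 e)
      have e2 := (h.adj_iff z y₂).not.2 (not_not.2 (h.same_equiv.trans e hs))
      tauto
  rw [(h.sch.diag _ _).2 this] at e
  simp at e

theorem exists_mutually_transposed (h : IsUniform A c s) {x y : V} (hxy : ¬ same c x y) :
    ∃ w w', same c w y ∧ same c w' y ∧ c x w' = (c x w).swap := by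
  by_cases hE : ∃ w, same c w y ∧ c x w = (1, 1)
  · obtain ⟨w, hw, e⟩ := hE
    exact ⟨w, w, hw, hw, by rw [e]; rfl⟩
  push Not at hE
  have hns : ∀ w, same c w y → ¬ same c x w := fun w hw e => hxy (h.same_equiv.trans e hw)
  have hcs : ∀ w, same c w y → c x w = s ∨ c x w = s.swap := fun w hw =>
    (h.cases_of_not_same (hns w hw)).resolve_left (hE w hw)
  have hy := h.same_equiv.refl y
  rcases hcs y hy with e | e
  · obtain ⟨w, hw, hne⟩ := h.exists_ne e
    exact ⟨y, w, hy, hw, by rw [e]; exact (hcs w hw).resolve_left hne⟩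
  · obtain ⟨v, hv, hne⟩ := h.exists_ne ((h.swap_eq_iff x y).1 e)
    have h1 : 0 < partCount c (· ≠ s) y x := h.partCount_pos.2 ⟨v, hne, hv⟩
    rw [h.partCount_swap] at h1
    obtain ⟨w, hw, hs⟩ := h.partCount_pos.1 h1
    have hw' : c x w = s :=
      (hcs w hs).resolve_right fun e' => hw (by rw [e', Prod.swap_swap])
    exact ⟨w, y, hs, hy, by rw [e, hw']⟩

theorem partCount_balanced (h : IsUniform A c s) {x y : V} (hxy : ¬ same c x y)
    (K : ℕ × ℕ → Prop) : partCount c K x y = partCount c (fun i => K i.swap) x y := by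
  obtain ⟨w, w', hw, hw', e⟩ := h.exists_mutually_transposed hxy
  exact h.partCount_symm hw hw' e K

theorem partCount_out_eq_in (h : IsUniform A c s) {x y : V} (hxy : ¬ same c x y) :
    partCount c (· = s) x y = partCount c (· = s.swap) x y := by
  rw [h.partCount_balanced hxy]
  exact ncard_congr_set fun w => and_congr_left fun _ => Prod.swap_eq_iff_eq_swap

theorem partCount_comm (h : IsUniform A c s) {x y : V} (hxy : ¬ same c x y) :
    partCount c (· = s) x y = partCount c (· = s) y x := by
  rw [h.partCount_out_eq_in hxy, h.partCount_singleton_swap, Prod.swap_swap]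

theorem card_part (h : IsUniform A c s) {x y : V} (hxy : ¬ same c x y) :
    {w | same c w y}.ncard =
      partCount c (· = s) x y + partCount c (· = s) x y + partCount c (· = (1, 1)) x y := by
  have hns : ∀ w, same c w y → ¬ same c x w := fun w hw e => hxy (h.same_equiv.trans e hw)
  have h1 := ncard_split (fun w => same c w y) (fun w => c x w = s)
  have h2 := ncard_split (fun w => same c w y ∧ ¬ c x w = s) (fun w => c x w = s.swap)
  have e1 : partCount c (· = s) x y = {w | same c w y ∧ c x w = s}.ncard :=
    ncard_congr_set fun w => and_comm
  have e2 : partCount c (· = s.swap) x y =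
      {w | (same c w y ∧ ¬ c x w = s) ∧ c x w = s.swap}.ncard :=
    ncard_congr_set fun w => ⟨fun e => ⟨⟨e.2, fun e' => h.ne_swap (e'.symm.trans e.1)⟩, e.1⟩,
      fun e => ⟨e.2, e.1.1⟩⟩
  have e3 : partCount c (· = (1, 1)) x y =
      {w | (same c w y ∧ ¬ c x w = s) ∧ ¬ c x w = s.swap}.ncard :=
    ncard_congr_set fun w => ⟨fun e => ⟨⟨e.2, fun e' => h.ne_edge (e'.symm.trans e.1)⟩,
      fun e' => h.swap_ne_edge (e'.symm.trans e.1)⟩, fun e =>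
      ⟨by_contra fun e' => ((h.cases_of_not_same (hns w e.1.1)).resolve_left e').elim e.1.2 e.2,
        e.1.1⟩⟩
  have := h.partCount_out_eq_in hxy
  omega

end IsUniform

/-- The 0-1 matrix of a colour class. -/
def colorMat (c : V → V → ℕ × ℕ) (i : ℕ × ℕ) : Matrix V V ℤ :=
  Matrix.of fun x y => if c x y = i then 1 else 0

theorem colorMat_mul_apply [Fintype V] (c : V → V → ℕ × ℕ) (i j : ℕ × ℕ) (x y : V) :
    (colorMat c i * colorMat c j) x y = (cnum c i j x y : ℤ) := by
  simp only [colorMat, Matrix.mul_apply, Matrix.of_apply, cnum, Set.ncard_eq_toFinset_card',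
    Set.toFinset_ofPred, ite_mul, one_mul, zero_mul, ← ite_and]
  rw [Finset.sum_boole]

theorem IsCScheme.exists_numbers {c : V → V → ℕ × ℕ} (h : IsCScheme c) :
    ∃ F : ℕ × ℕ → ℕ × ℕ → ℕ × ℕ → ℕ, ∀ i j x y, cnum c i j x y = F i j (c x y) := by
  classical
  refine ⟨fun i j e => if he : ∃ p : V × V, c p.1 p.2 = e then
    cnum c i j he.choose.1 he.choose.2 else 0, fun i j x y => ?_⟩
  have he : ∃ p : V × V, c p.1 p.2 = c x y := ⟨(x, y), rfl⟩
  simp only [dif_pos he]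
  exact h.reg _ _ _ _ _ _ he.choose_spec.symm

theorem IsCScheme.cnum_swap {c : V → V → ℕ × ℕ} (h : IsCScheme c) (i j : ℕ × ℕ) (x y : V) :
    cnum c i.swap j.swap x y = cnum c j i y x := by
  refine ncard_congr_set fun z => ?_
  rw [h.swap z x, h.swap y z, Prod.swap_inj, Prod.swap_inj, and_comm]

theorem IsCScheme.cnum_self {c : V → V → ℕ × ℕ} (h : IsCScheme c) {i j : ℕ × ℕ}
    (hij : j ≠ i.swap) (x : V) : cnum c i j x x = 0 := by
  refine (congrArg Set.ncard (Set.eq_empty_iff_forall_notMem.2 ?_)).trans (Set.ncard_empty V)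
  rintro z ⟨rfl, rfl⟩
  exact hij (h.swap x z)

namespace IsReduced

variable [Fintype V] {A : V → V → Prop} {c : V → V → ℕ × ℕ}

theorem card_same (h : IsReduced A c) (x y : V) :
    {w | same c w x}.ncard = {w | same c w y}.ncard := by
  have key : ∀ x, {w | same c w x}.ncard = cval c (fun i => i = (0, 0) ∨ i = (2, 2)) x := fun x =>
    ncard_congr_set fun w =>
      ⟨fun e => (h.same_iff x w).1 (h.same_equiv.symm e),
        fun e => h.same_equiv.symm ((h.same_iff x w).2 e)⟩
  rw [key, key, h.sch.cval_reg _ x y]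

theorem exists_team (h : IsReduced A c) : ∃ (k r : ℕ) (f : V → Fin k),
    IsTeamSMD A f r ∧ ∀ x y, f x = f y ↔ same c x y := by
  obtain ⟨k, f, hf, hfs⟩ := exists_labelling (same c) h.same_equiv
  obtain ⟨x, y, hxy⟩ := h.exists_nonadj
  obtain ⟨u, v, huv, -⟩ := h.exists_asymm
  refine ⟨k, {w | same c w x}.ncard, f, ⟨?_, ?_, h.irrefl, fun i => ?_, fun u v _ => ?_⟩, hfs⟩
  · by_contra hk
    have : Subsingleton (Fin k) := Fin.subsingleton_iff_le_one.2 (by omega)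
    exact h.not_same_of_arc huv ((hfs u v).1 (Subsingleton.elim _ _))
  · refine (Set.one_lt_ncard (Set.toFinite _)).2 ⟨x, h.same_equiv.refl x, y,
      h.same_equiv.symm (Or.inr hxy), ?_⟩
    rintro rfl
    rw [(h.sch.diag x x).2 rfl] at hxy
    simp at hxy
  · obtain ⟨z, rfl⟩ := hf i
    simp only [hfs]
    exact h.card_same z x
  · rw [h.adj_iff, Ne, hfs]

theorem exists_valency (h : IsReduced A c) : ∃ k, IsRegularOfValency A k := by
  obtain ⟨x₀, -⟩ := h.exists_nonadj
  refine ⟨{y | A x₀ y}.ncard, fun x => ⟨h.outdegree x x₀, ?_⟩⟩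
  rw [← h.outdegree x x₀]
  have := h.sch.cval_swap (fun i => i.1 = 1) x
  simpa only [cval, Prod.fst_swap, h.arc, h.arc'] using this

end IsReduced

namespace IsUniform

variable {A : V → V → Prop} {c : V → V → ℕ × ℕ} {s : ℕ × ℕ}

theorem matE_eq (h : IsUniform A c s) : matE A = colorMat c (1, 1) := by
  ext x y
  simp only [matE, colorMat, Matrix.of_apply]
  classical exact if_congr (h.edge_iff x y).symm rfl rfl

theorem matAr_eq (h : IsUniform A c s) : matAr A = colorMat c s := by
  ext x y
  simp only [matAr, colorMat, Matrix.of_apply]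
  classical exact if_congr (h.eq_iff x y).symm rfl rfl

theorem transpose_eq (h : IsUniform A c s) : (colorMat c s)ᵀ = colorMat c s.swap := by
  ext x y
  simp only [colorMat, Matrix.of_apply, Matrix.transpose_apply, h.swap_eq_iff]

theorem one_eq [DecidableEq V] (h : IsUniform A c s) :
    (1 : Matrix V V ℤ) = colorMat c (0, 0) := by
  ext x y
  simp only [colorMat, Matrix.of_apply, Matrix.one_apply, h.sch.diag]

theorem sum_colorMat (h : IsUniform A c s) :
    matJ V - colorMat c (0, 0) - colorMat c s - colorMat c s.swap - colorMat c (1, 1) =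
      colorMat c (2, 2) := by
  have h1 := h.ne_swap
  have h2 := h.ne_edge
  have h3 := h.swap_ne_edge
  have h4 : s ≠ (0, 0) := fun e => by have := h.fst; simp [e] at this
  have h5 : s ≠ (2, 2) := fun e => by have := h.fst; simp [e] at this
  have h6 : s.swap ≠ (0, 0) := fun e => h4 (Prod.swap_injective e)
  have h7 : s.swap ≠ (2, 2) := fun e => h5 (Prod.swap_injective e)
  ext x y
  simp only [matJ, colorMat, Matrix.sub_apply, Matrix.of_apply]
  rcases h.cases x y with e | e | e | e | e <;>
    simp [e, h1, h2, h3, h4, h5, h6, h7, h1.symm, h2.symm, h3.symm, h4.symm, h5.symm, h6.symm,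
      h7.symm]

theorem exists_pair (h : IsUniform A c s) : ∃ x y, c x y = s := by
  obtain ⟨x, y, h1, h2⟩ := h.exists_asymm
  exact ⟨x, y, h.uniform x y h1 h2⟩

variable [Fintype V]

theorem colorMat_mul (h : IsUniform A c s) {F : ℕ × ℕ → ℕ × ℕ → ℕ × ℕ → ℕ}
    (hF : ∀ i j x y, cnum c i j x y = F i j (c x y)) (i j : ℕ × ℕ) :
    colorMat c i * colorMat c j = (F i j (0, 0) : ℤ) • colorMat c (0, 0) +
      (F i j s : ℤ) • colorMat c s + (F i j s.swap : ℤ) • colorMat c s.swap +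
      (F i j (1, 1) : ℤ) • colorMat c (1, 1) + (F i j (2, 2) : ℤ) • colorMat c (2, 2) := by
  have h1 := h.ne_swap
  have h2 := h.ne_edge
  have h3 := h.swap_ne_edge
  have h4 : s ≠ (0, 0) := fun e => by have := h.fst; simp [e] at this
  have h5 : s ≠ (2, 2) := fun e => by have := h.fst; simp [e] at this
  have h6 : s.swap ≠ (0, 0) := fun e => h4 (Prod.swap_injective e)
  have h7 : s.swap ≠ (2, 2) := fun e => h5 (Prod.swap_injective e)
  ext x y
  rw [colorMat_mul_apply, hF]
  simp only [colorMat, Matrix.add_apply, Matrix.smul_apply, Matrix.of_apply, smul_eq_mul]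
  rcases h.cases x y with e | e | e | e | e <;>
    simp [e, h1, h2, h3, h4, h5, h6, h7, h1.symm, h2.symm, h3.symm, h4.symm, h5.symm, h6.symm,
      h7.symm]

theorem card_eq_sum (h : IsUniform A c s) (i : ℕ × ℕ) (x y : V) :
    {z | c x z = i}.ncard = partCount c (· = i) x y + cnum c i (1, 1) x y + cnum c i s x y +
      cnum c i s.swap x y := by
  have h1 := ncard_split (fun z => c x z = i) (fun z => same c z y)
  have h2 := ncard_split (fun z => c x z = i ∧ ¬ same c z y) (fun z => c z y = (1, 1))
  have h3 := ncard_split (fun z => (c x z = i ∧ ¬ same c z y) ∧ ¬ c z y = (1, 1))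
    (fun z => c z y = s)
  have e1 : partCount c (· = i) x y = {z | c x z = i ∧ same c z y}.ncard := rfl
  have e2 : cnum c i (1, 1) x y = {z | (c x z = i ∧ ¬ same c z y) ∧ c z y = (1, 1)}.ncard :=
    ncard_congr_set fun z => ⟨fun e => ⟨⟨e.1, h.not_same_of_arc ((h.edge_iff z y).1 e.2).1⟩, e.2⟩,
      fun e => ⟨e.1.1, e.2⟩⟩
  have e3 : cnum c i s x y =
      {z | ((c x z = i ∧ ¬ same c z y) ∧ ¬ c z y = (1, 1)) ∧ c z y = s}.ncard :=
    ncard_congr_set fun z => ⟨fun e => ⟨⟨⟨e.1, h.not_same e.2⟩, fun e' =>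
      h.ne_edge (e.2.symm.trans e')⟩, e.2⟩, fun e => ⟨e.1.1.1, e.2⟩⟩
  have e4 : cnum c i s.swap x y =
      {z | ((c x z = i ∧ ¬ same c z y) ∧ ¬ c z y = (1, 1)) ∧ ¬ c z y = s}.ncard :=
    ncard_congr_set fun z => ⟨fun e => ⟨⟨⟨e.1, fun e' =>
      h.not_same ((h.swap_eq_iff z y).1 e.2) (h.same_equiv.symm e')⟩, fun e' =>
      h.swap_ne_edge (e.2.symm.trans e')⟩, fun e' => h.ne_swap (e'.symm.trans e.2)⟩,
      fun e => ⟨e.1.1.1, ((h.cases_of_not_same e.1.1.2).resolve_left e.1.2).resolve_left e.2⟩⟩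
  omega

theorem card_out_eq_card_in (h : IsUniform A c s) (x : V) :
    {z | c x z = s}.ncard = {z | c x z = s.swap}.ncard := by
  refine (h.sch.cval_swap (· = s) x).symm.trans (ncard_congr_set fun z => ?_)
  exact Prod.swap_eq_iff_eq_swap

theorem balance (h : IsUniform A c s) {F : ℕ × ℕ → ℕ × ℕ → ℕ × ℕ → ℕ}
    (hF : ∀ i j x y, cnum c i j x y = F i j (c x y)) :
    F (1, 1) s s.swap + F s s s.swap = F (1, 1) s s + F s s s := by
  obtain ⟨x, y, e⟩ := h.exists_pair
  have e' : c y x = s.swap := by rw [h.sch.swap x y, e]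
  have h1 := h.card_eq_sum s x y
  have h2 := h.card_eq_sum s.swap x y
  rw [h.card_out_eq_card_in, h.partCount_out_eq_in (h.not_same e)] at h1
  have h3 : cnum c s.swap (1, 1) x y = cnum c (1, 1) s y x := h.sch.cnum_swap s (1, 1) x y
  have h4 := h.sch.cnum_swap s s x y
  have h5 := h.sch.comm s.swap s x y
  have h6 := h.sch.comm s (1, 1) x y
  rw [hF _ _ y x, e'] at h3 h4
  have h7 : cnum c (1, 1) s x y = F (1, 1) s s := by rw [hF, e]
  have h8 : cnum c s s x y = F s s s := by rw [hF, e]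
  rw [← h3, ← h4, ← h7, ← h8]
  omega

theorem drConstEq (h : IsUniform A c s) {F : ℕ × ℕ → ℕ × ℕ → ℕ × ℕ → ℕ}
    (hF : ∀ i j x y, cnum c i j x y = F i j (c x y)) :
    ∃ t α β γ η, DRConstEq A t α β γ η ∧ β 1 + β 2 - α 1 - α 2 = 0 := by
  let i : ℕ → ℕ × ℕ := fun k => if k = 2 then s else (1, 1)
  let j : ℕ → ℕ × ℕ := fun k => if k = 0 then (1, 1) else s
  refine ⟨F (1, 1) (1, 1) (0, 0), fun k => F (i k) (j k) s, fun k => F (i k) (j k) s.swap,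
    fun k => F (i k) (j k) (1, 1), fun k => F (i k) (j k) (2, 2), ?_, ?_⟩
  · obtain ⟨x, -⟩ := h.exists_nonadj
    have hx := (h.sch.diag x x).2 rfl
    have z1 : F (1, 1) s (0, 0) = 0 := by
      rw [← hx, ← hF]; exact h.sch.cnum_self h.ne_edge x
    have z2 : F s s (0, 0) = 0 := by
      rw [← hx, ← hF]; exact h.sch.cnum_self h.ne_swap x
    have hcomm : colorMat c s * colorMat c (1, 1) = colorMat c (1, 1) * colorMat c s := by
      ext x y
      rw [colorMat_mul_apply, colorMat_mul_apply, h.sch.comm]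
    intro a b
    classical
    rw [h.matE_eq, h.matAr_eq, h.one_eq, h.transpose_eq, h.sum_colorMat]
    fin_cases a <;> fin_cases b
    · simpa [i, j] using h.colorMat_mul hF (1, 1) (1, 1)
    · simpa [i, j, z1] using h.colorMat_mul hF (1, 1) s
    · simpa [i, j, z1, hcomm] using h.colorMat_mul hF (1, 1) s
    · simpa [i, j, z2] using h.colorMat_mul hF s s
  · have := h.balance hF
    simp only [i, j]
    norm_num
    omega

/-- The constants of type II. -/
theorem typeII (h : IsUniform A c s) {k r : ℕ} {f : V → Fin k} (hf : IsTeamSMD A f r)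
    (hfs : ∀ x y, f x = f y ↔ same c x y) {i j : Fin k} (hij : i ≠ j) : ∃ a e : ℕ,
    (∀ x, f x = i → (Aplus A f j x).ncard = a ∧ (Epart A f j x).ncard = e) ∧
    (∀ y, f y = j → (Aplus A f i y).ncard = a) ∧ a + a + e = r := by
  have hne : ∀ i, ∃ x, f x = i := fun i =>
    ncard_pos_iff.1 (by rw [hf.2.2.2.1 i]; have := hf.2.1; omega)
  have hA : ∀ x y, (Aplus A f (f y) x).ncard = partCount c (· = s) x y := fun x y =>
    ncard_congr_set fun z => (and_congr (hfs z y) (h.eq_iff x z).symm).trans and_comm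
  have hE : ∀ x y, (Epart A f (f y) x).ncard = partCount c (· = (1, 1)) x y := fun x y =>
    ncard_congr_set fun z => (and_congr (hfs z y) (h.edge_iff x z).symm).trans and_comm
  obtain ⟨x, rfl⟩ := hne i
  obtain ⟨y, rfl⟩ := hne j
  have hxy : ¬ same c x y := fun e => hij ((hfs x y).2 e)
  refine ⟨partCount c (· = s) x y, partCount c (· = (1, 1)) x y, fun x' e => ⟨?_, ?_⟩,
    fun y' e => ?_, ?_⟩
  · rw [hA, h.partCount_left _ ((hfs _ _).1 e)]
  · rw [hE, h.partCount_left _ ((hfs _ _).1 e)]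
  · rw [hA, h.partCount_left _ ((hfs _ _).1 e), h.partCount_comm hxy]
  · rw [← h.card_part hxy, ← hf.2.2.2.1 (f y)]
    exact ncard_congr_set fun w => (hfs w y).symm

/-- A uniform digraph is a doubly regular team semicomplete multipartite digraph of type II. -/
theorem exists_doublyRegular (h : IsUniform A c s) : ∃ (k m : ℕ) (f : V → Fin k),
    2 ≤ k ∧ 2 ≤ m ∧ IsTeamSMD A f m ∧ (∃ kk, IsRegularOfValency A kk) ∧
    ∃ t α β γ η, DRConstEq A t α β γ η ∧ TypeII A f m α β := by
  obtain ⟨k, m, f, hf, hfs⟩ := h.exists_team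
  obtain ⟨F, hF⟩ := h.sch.exists_numbers
  obtain ⟨t, α, β, γ, η, h1, h2⟩ := h.drConstEq hF
  exact ⟨k, m, f, hf.1, hf.2.1, hf, h.exists_valency, t, α, β, γ, η, h1, h2,
    fun i j hij => h.typeII hf hfs hij⟩

/-- A uniform digraph without opposite arcs is a doubly regular team tournament of type II. -/
theorem exists_tournament (h : IsUniform A c s) (hE : ∀ x y, ¬ (A x y ∧ A y x)) :
    ∃ (k l : ℕ) (f : V → Fin k) (α β γ : ℤ), 2 ≤ k ∧ 2 ≤ l ∧ IsDRTeamTournament A f l α β γ ∧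
      TournamentTypeII A f l α β ∧ 4 * α = ((k : ℤ) - 2) * (l : ℤ) ∧ β = α ∧
      4 * ((l : ℤ) - 1) * γ = (l : ℤ) ^ 2 * ((k : ℤ) - 1) := by
  obtain ⟨k, l, f, hf, hfs⟩ := h.exists_team
  obtain ⟨F, hF⟩ := h.sch.exists_numbers
  have hE' : ∀ x y, c x y ≠ (1, 1) := fun x y e => hE x y ((h.edge_iff x y).1 e)
  have hz : ∀ j x y, cnum c (1, 1) j x y = 0 := fun j x y =>
    ncard_zero_iff.2 fun z e => hE' _ _ e.1
  have hs : ∀ x y, c x y = s ↔ A x y := fun x y =>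
    (h.eq_iff x y).trans ⟨fun e => e.1, fun e => ⟨e, fun e' => hE x y ⟨e, e'⟩⟩⟩
  obtain ⟨x, y, e⟩ := h.exists_pair
  have e' : c y x = s.swap := by rw [h.sch.swap x y, e]
  have hab : F s s s.swap = F s s s := by
    have h1 := h.balance hF
    rw [← e', ← hF (1, 1), ← e, ← hF (1, 1), hz, hz, e, e'] at h1
    omega
  have hhalf : ∀ x y, ¬ same c x y → 2 * partCount c (· = s) x y = l := fun x y hxy => by
    have h1 := h.card_part hxy
    have h2 : partCount c (· = (1, 1)) x y = 0 :=
      h.partCount_eq_zero.2 fun w _ => hE' x w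
    have h3 : {w | same c w y}.ncard = l := by
      rw [← hf.2.2.2.1 (f y)]
      exact ncard_congr_set fun w => (hfs w y).symm
    omega
  have hpart : ∀ x, {w | same c w x}.ncard = l := fun x => by
    rw [← hf.2.2.2.1 (f x)]
    exact ncard_congr_set fun w => (hfs w x).symm
  have hmat : matAdj A = colorMat c s := by
    ext x y
    simp only [matAdj, colorMat, Matrix.of_apply]
    classical exact if_congr (hs x y).symm rfl rfl
  have hzero : colorMat c (1, 1) = 0 := by
    ext x y
    simp [colorMat, hE']
  set d := {z | c x z = s}.ncard with hd
  have hd0 : 0 < d := ncard_pos_iff.2 ⟨y, e⟩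
  set p := partCount c (· = s) x y with hp
  have hl : 2 * p = l := hhalf x y (h.not_same e)
  have hpz : ∀ z, c x z = s → partCount c (· = s) z x = p := fun z hz => by
    have h1 := hhalf z x fun e => h.not_same hz (h.same_equiv.symm e)
    omega
  -- Each out-neighbour of `x` has as many out- as in-neighbours among the out-neighbours of `x`.
  have htri : cnum c s s.swap x y = F s s s := by
    refine Nat.eq_of_mul_eq_mul_left hd0 (double_count (p := fun z => c x z = s)
      (q := fun z => c x z = s) (R := fun a b => c b a = s.swap) (fun a ha => ?_) fun b hb => ?_)
    · exact h.sch.reg _ _ _ _ _ _ (ha.trans e.symm)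
    · rw [← hb, ← hF, hb]
      exact ncard_congr_set fun z => and_congr_right fun _ => h.swap_eq_iff b z
  have hdeg : d = p + F s s s + F s s s := by
    have h1 := h.card_eq_sum s x y
    have h2 : cnum c s s x y = F s s s := by rw [hF, e]
    rw [h.sch.comm, hz, htri, h2] at h1
    exact h1
  have hcard : k * l = l + d + d := by
    obtain ⟨ε, -⟩ := exists_fibre_equiv f hf.2.2.2.1
    have h1 := Nat.card_congr ε
    rw [Nat.card_prod, Nat.card_fin, Nat.card_fin, ← Set.ncard_univ] at h1
    have h2 := ncard_split (fun _ : V => True) (fun w => same c w x)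
    have h3 := ncard_split (fun w => True ∧ ¬ same c w x) (fun w => c x w = s)
    have e1 : {w | True ∧ same c w x}.ncard = l := by
      rw [← hpart x]; exact ncard_congr_set fun w => ⟨fun e => e.2, fun e => ⟨trivial, e⟩⟩
    have e2 : {w | (True ∧ ¬ same c w x) ∧ c x w = s}.ncard = d :=
      ncard_congr_set fun w => ⟨fun e => e.2, fun e =>
        ⟨⟨trivial, fun e' => h.not_same e (h.same_equiv.symm e')⟩, e⟩⟩
    have e3 : {w | (True ∧ ¬ same c w x) ∧ ¬ c x w = s}.ncard = d := by
      rw [hd, h.card_out_eq_card_in]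
      refine ncard_congr_set fun w => ⟨fun e => ?_, fun e => ⟨⟨trivial, fun e' => ?_⟩, fun e' => ?_⟩⟩
      · exact ((h.cases_of_not_same fun e' => e.1.2 (h.same_equiv.symm e')).resolve_left
          (hE' x w)).resolve_left e.2
      · exact h.not_same ((h.swap_eq_iff x w).1 e) e'
      · exact h.ne_swap (e'.symm.trans e)
    rw [← h1]
    change {w | True}.ncard = _
    omega
  have hgam : (l - 1) * F s s (2, 2) = d * p := by
    have h1 : {w | c x w = (2, 2)}.ncard = l - 1 := by
      have h2 := ncard_split (fun w => same c w x) (fun w => w = x)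
      have e1 : {w | same c w x ∧ w = x}.ncard = 1 := by
        rw [ncard_congr_set (q := fun w => w = x) fun w =>
          ⟨fun e => e.2, fun e => ⟨Or.inl e, e⟩⟩]
        exact Set.ncard_singleton x
      have e2 : {w | same c w x ∧ ¬ w = x}.ncard = {w | c x w = (2, 2)}.ncard :=
        ncard_congr_set fun w => ⟨fun e => swap_eq_of_eq h.toIsReduced (e.1.resolve_left e.2),
          fun e => ⟨Or.inr (swap_eq_of_eq h.toIsReduced e), fun e' => by
            rw [(h.sch.diag x w).2 e'.symm] at e; simp at e⟩⟩
      rw [hpart] at h2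
      omega
    rw [← h1]
    refine double_count (p := fun w => c x w = (2, 2)) (q := fun z => c x z = s)
      (R := fun w z => c z w = s) (fun w hw => ?_) fun z hz => ?_
    · rw [← hw, ← hF]
      rfl
    · rw [← hpz z hz]
      refine ncard_congr_set fun w => ⟨fun e => ⟨e.2, Or.inr (swap_eq_of_eq h.toIsReduced e.1)⟩,
        fun e => ⟨swap_eq_of_eq h.toIsReduced (e.2.resolve_left ?_), e.1⟩⟩
      rintro rfl
      exact h.ne_swap (e.1.symm.trans (by rw [h.sch.swap w z, hz]))
  have hl2 := hf.2.1
  refine ⟨k, l, f, F s s s, F s s s.swap, F s s (2, 2), hf.1, hf.2.1,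
    ⟨⟨hf, hE⟩, h.exists_valency, ?_⟩, ⟨congrArg _ hab, ⟨p, by omega⟩, fun i u hu => ?_⟩, ?_,
    congrArg _ hab, ?_⟩
  · classical
    have z2 : F s s (0, 0) = 0 := by
      rw [← (h.sch.diag x x).2 rfl, ← hF]; exact h.sch.cnum_self h.ne_swap x
    have h1 := h.sum_colorMat
    rw [hzero, sub_zero] at h1
    rw [hmat, h.one_eq, h.transpose_eq, h1, h.colorMat_mul hF, hzero, z2]
    simp
  · obtain ⟨v, rfl⟩ : ∃ v, f v = i :=
      ncard_pos_iff.1 (by rw [hf.2.2.2.1 i]; omega)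
    rw [← hhalf u v fun e => hu ((hfs u v).2 e)]
    congr 1
    exact ncard_congr_set fun w => (and_congr (hfs w v) (hs u w).symm).trans and_comm
  · zify at hcard hdeg hl
    rw [hdeg] at hcard
    linarith
  · zify [show 1 ≤ l by omega] at hcard hgam hl
    have : 4 * ((l : ℤ) - 1) * F s s (2, 2) = 2 * d * (2 * p) := by
      rw [mul_assoc, hgam]; ring
    rw [this, hl, show 2 * (d : ℤ) = k * l - l by linarith]
    ring

end IsUniform

theorem IsReduced.isUniform_or [Fintype V] {A : V → V → Prop} {c : V → V → ℕ × ℕ}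
    (h : IsReduced A c) :
    IsFarSymm A c ∨ IsFarMixed A c ∨ IsUniform A c (1, 2) ∨ IsUniform A c (1, 3) := by
  have key : ∀ x y, A x y → ¬ A y x → c x y = (1, 2) ∨ c x y = (1, 3) := fun x y h1 h2 =>
    (h.arc_colors h1).resolve_left fun e => h2 ((h.edge_iff x y).1 e).2
  by_cases hfar : ∃ x y, c x y = (1, 3)
  · by_cases hnear : ∃ x y, c x y = (1, 2)
    · rcases h.farSymm_or_farMixed hfar hnear with h1 | h1
      · exact Or.inl h1
      · exact Or.inr (Or.inl h1)
    · push Not at hnear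
      exact Or.inr (Or.inr (Or.inr ⟨h, rfl, by norm_num, fun x y h1 h2 =>
        (key x y h1 h2).resolve_left (hnear x y)⟩))
  · push Not at hfar
    exact Or.inr (Or.inr (Or.inl ⟨h, rfl, by norm_num, fun x y h1 h2 =>
      (key x y h1 h2).resolve_right (hfar x y)⟩))

/-! ### Isomorphisms and coclique extensions -/

theorem Iso.trans {U : Type*} {A : V → V → Prop} {B : W → W → Prop} {C : U → U → Prop}
    (h : Iso A B) (k : Iso B C) : Iso A C := by
  obtain ⟨e, he⟩ := h
  obtain ⟨e', he'⟩ := k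
  exact ⟨e.trans e', fun x y => (he x y).trans (he' _ _)⟩

theorem Iso.symm {A : V → V → Prop} {B : W → W → Prop} (h : Iso A B) : Iso B A := by
  obtain ⟨e, he⟩ := h
  exact ⟨e.symm, fun x y => by rw [he, e.apply_symm_apply, e.apply_symm_apply]⟩

theorem cocliqueExt_iff {A : V → V → Prop} {n : ℕ} (p q : V × Fin n) :
    cocliqueExt A n p q ↔ A p.1 q.1 := by
  simp [cocliqueExt, lexProd]

theorem Iso.cocliqueExt {A : V → V → Prop} {B : W → W → Prop} (h : Iso A B) (n : ℕ) :
    Iso (cocliqueExt A n) (cocliqueExt B n) := by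
  obtain ⟨e, he⟩ := h
  refine ⟨e.prodCongr (Equiv.refl _), fun x y => ?_⟩
  rw [cocliqueExt_iff, cocliqueExt_iff]
  exact he _ _

theorem iso_cocliqueExt_one (A : V → V → Prop) : Iso (cocliqueExt A 1) A :=
  ⟨Equiv.prodUnique V (Fin 1), fun x y => cocliqueExt_iff x y⟩

/-! ### Semicomplete multipartite digraphs -/

/-- Every vertex has a non-neighbour other than itself. -/
def HasMates (A : V → V → Prop) : Prop :=
  ∀ x, ∃ y, y ≠ x ∧ ¬ (A x y ∨ A y x)

theorem NonadjTrans.comap {A : V → V → Prop} {B : W → W → Prop} (h : NonadjTrans B) {g : V → W}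
    (hg : ∀ x y, A x y ↔ B (g x) (g y)) : NonadjTrans A := by
  intro x y z
  simp only [hg]
  exact h _ _ _

theorem IsSemicompleteMultipartiteWith.nonadjTrans {A : V → V → Prop} {m : ℕ} {f : V → Fin m}
    (h : IsSemicompleteMultipartiteWith A f) : NonadjTrans A := by
  have key : ∀ x y, ¬ (A x y ∨ A y x) ↔ f x = f y := by
    intro x y
    by_cases hxy : x = y
    · subst hxy
      simp [h.1 x]
    · rw [h.2.2 x y hxy, not_not]
  intro x y z
  rw [key, key, key]
  exact Eq.trans

theorem IsSemicompleteMultipartiteWith.hasMates [Finite V] {A : V → V → Prop} {m : ℕ}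
    {f : V → Fin m} (h : IsSemicompleteMultipartiteWith A f) : HasMates A := by
  intro x
  obtain ⟨y, hy, hne⟩ := Set.exists_ne_of_one_lt_ncard (h.2.1 (f x)) x
  exact ⟨y, hne, fun e => (h.2.2 x y hne.symm).1 e (Eq.symm hy)⟩

theorem IsTeamSMD.isSemicompleteMultipartiteWith {A : V → V → Prop} {m r : ℕ} {f : V → Fin m}
    (h : IsTeamSMD A f r) : IsSemicompleteMultipartiteWith A f :=
  ⟨h.2.2.1, fun i => by rw [h.2.2.2.1 i]; exact h.2.1, h.2.2.2.2⟩

theorem IsSemicomplete.nonadjTrans {A : V → V → Prop} (h : IsSemicomplete A) :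
    NonadjTrans A := by
  intro x y z hxy hyz
  have h1 : x = y := by_contra fun e => hxy (h.2 x y e)
  rwa [h1]

theorem isSemicompleteMultipartite_of_hasMates [Finite V] {A : V → V → Prop}
    (hirr : ∀ x, ¬ A x x) (harc : ∃ x y, A x y) (h : NonadjTrans A) (hm : HasMates A) :
    IsSemicompleteMultipartite A := by
  obtain ⟨m, f, hf, hfs⟩ := exists_labelling (fun x y => ¬ (A x y ∨ A y x))
    ⟨fun x => by simp [hirr x], fun e => mt Or.symm e, fun e e' => h _ _ _ e e'⟩
  refine ⟨m, ?_, f, hirr, fun i => ?_, fun x y _ => by rw [Ne, hfs, not_not]⟩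
  · obtain ⟨x, y, hxy⟩ := harc
    by_contra hk
    have : Subsingleton (Fin m) := Fin.subsingleton_iff_le_one.2 (by omega)
    exact (hfs x y).1 (Subsingleton.elim _ _) (Or.inl hxy)
  · obtain ⟨x, rfl⟩ := hf i
    obtain ⟨y, hne, hxy⟩ := hm x
    exact (Set.one_lt_ncard (Set.toFinite _)).2
      ⟨y, ((hfs x y).2 hxy).symm, x, rfl, hne⟩

theorem isSemicompleteMultipartite_of_iso_cocliqueExt [Finite V] {A : V → V → Prop}
    {S : W → W → Prop} {n : ℕ} (hirr : ∀ x, ¬ A x x) (harc : ∃ x y, A x y)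
    (hiso : Iso A (cocliqueExt S n)) (hS : NonadjTrans S) (hm : HasMates S ∨ 2 ≤ n) :
    IsSemicompleteMultipartite A := by
  obtain ⟨e, he⟩ := hiso
  have he' : ∀ x y, A x y ↔ S (e x).1 (e y).1 := fun x y => (he x y).trans (cocliqueExt_iff _ _)
  refine isSemicompleteMultipartite_of_hasMates hirr harc (hS.comap he') fun x => ?_
  have key : ∀ p, p ≠ e x → ¬ (S (e x).1 p.1 ∨ S p.1 (e x).1) →
      ∃ y, y ≠ x ∧ ¬ (A x y ∨ A y x) := by
    intro p hp hadj
    refine ⟨e.symm p, fun h => hp (by rw [← h, e.apply_symm_apply]), ?_⟩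
    rwa [he', he', e.apply_symm_apply]
  rcases hm with hm | hn
  · obtain ⟨t, ht, hadj⟩ := hm (e x).1
    exact key (t, (e x).2) (fun h => ht (congrArg Prod.fst h)) hadj
  · have : Nontrivial (Fin n) := Fin.nontrivial_iff_two_le.2 hn
    obtain ⟨i, hi⟩ := exists_ne (e x).2
    refine key ((e x).1, i) (fun h => hi (congrArg Prod.snd h)) ?_
    rw [← he', or_self]
    exact hirr x

theorem cay6_nonadjTrans : NonadjTrans Cay6 := by
  unfold NonadjTrans Cay6
  decide

theorem cay6_hasMates : HasMates Cay6 := by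
  unfold HasMates Cay6
  decide

theorem c4_nonadjTrans : NonadjTrans C4 := by
  unfold NonadjTrans C4
  decide

theorem c4_hasMates : HasMates C4 := by
  unfold HasMates C4
  decide

theorem lexProd_nonadjTrans {A : V → V → Prop} {B : W → W → Prop} (hA : IsSemicomplete A)
    (hB : NonadjTrans B) : NonadjTrans (lexProd A B) := by
  have key : ∀ x y, ¬ (lexProd A B x y ∨ lexProd A B y x) ↔
      x.1 = y.1 ∧ ¬ (B x.2 y.2 ∨ B y.2 x.2) := by
    intro x y
    unfold lexProd
    by_cases hxy : x.1 = y.1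
    · simp [hxy, hA.1 y.1]
    · have := hA.2 _ _ hxy
      tauto
  intro x y z
  rw [key, key, key]
  exact fun h k => ⟨h.1.trans k.1, hB _ _ _ h.2 k.2⟩

theorem lexProd_hasMates {A : V → V → Prop} {B : W → W → Prop} (hA : ∀ x, ¬ A x x)
    (hB : HasMates B) : HasMates (lexProd A B) := by
  intro x
  obtain ⟨u, hu, hadj⟩ := hB x.2
  refine ⟨(x.1, u), fun e => hu (congrArg Prod.snd e), ?_⟩
  simpa [lexProd, hA x.1] using hadj

theorem IsWDRD.exists_arc {A : V → V → Prop} (h : IsWDRD A) : ∃ x y, A x y := by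
  obtain ⟨d, ⟨x, y, rfl⟩, hd⟩ := h.2.1
  obtain ⟨n, hn⟩ := h.1 x y
  rcases n with _ | n
  · rw [hasPath_zero] at hn
    subst hn
    exact absurd rfl hd
  · obtain ⟨z, hz, -⟩ := hasPath_succ.1 hn
    exact ⟨x, z, hz⟩

/-- classification of semicomplete multipartite commutative weakly
distance-regular digraphs. -/
theorem statement_0 {V : Type*} [Fintype V] [Nonempty V] (A : V → V → Prop)
    (hirr : ∀ x, ¬ A x x) (h : IsCWDRD A) :
    IsSemicompleteMultipartite A ↔
      ((∃ n : ℕ, 1 ≤ n ∧ Iso A (cocliqueExt Cay6 n)) ∨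
       (∃ l : ℕ, 2 ≤ l ∧ ∃ (N : ℕ) (S : Fin N → Fin N → Prop), 1 ≤ N ∧
          IsSemicomplete S ∧ IsWDRD S ∧ (girth S = 2 ∨ girth S = 3) ∧
          Iso A (cocliqueExt S l)) ∨
       (∃ n : ℕ, 1 ≤ n ∧ ∃ (N : ℕ) (S : Fin N → Fin N → Prop), 1 ≤ N ∧
          IsSemicomplete S ∧ IsWDRD S ∧ girth S = 3 ∧
          Iso A (cocliqueExt (lexProd S C4) n)) ∨
       (∃ k l n : ℕ, 2 ≤ k ∧ 2 ≤ l ∧ 1 ≤ n ∧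
          ∃ (N : ℕ) (B : Fin N → Fin N → Prop) (f : Fin N → Fin k) (α β γ : ℤ),
            IsDRTeamTournament B f l α β γ ∧
            TournamentTypeII B f l α β ∧
            4 * α = ((k : ℤ) - 2) * (l : ℤ) ∧ β = α ∧
            4 * ((l : ℤ) - 1) * γ = (l : ℤ) ^ 2 * ((k : ℤ) - 1) ∧
            Iso A (cocliqueExt B n)) ∨
       (∃ k m : ℕ, 2 ≤ k ∧ 2 ≤ m ∧
          ∃ (N : ℕ) (B : Fin N → Fin N → Prop) (f : Fin N → Fin k),
            IsTeamSMD B f m ∧ (∃ kk, IsRegularOfValency B kk) ∧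
            (∃ t α β γ η, DRConstEq B t α β γ η ∧ TypeII B f m α β) ∧
            Iso A B)) := by
  constructor
  · rintro ⟨m, -, f, hf⟩
    obtain ⟨N, n, S, hN, hn, hiso, hSirr, hS, htw, hn1⟩ := exists_twin_quotient hirr h
    have : Nonempty (Fin N) := ⟨⟨0, hN⟩⟩
    have hSna : NonadjTrans S := by
      obtain ⟨e, he⟩ := hiso
      refine hf.nonadjTrans.comap (g := fun s => e.symm (s, ⟨0, hn⟩)) fun s t => ?_
      rw [he, cocliqueExt_iff, e.apply_symm_apply, e.apply_symm_apply]
    by_cases hsc : ∀ s t, s ≠ t → S s t ∨ S t s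
    · refine Or.inr (Or.inl ⟨n, ?_, N, S, hN, ⟨hSirr, hsc⟩, hS.1, girth_of_semicomplete
        ⟨hSirr, hsc⟩ (outdegree_eq hSirr hS) hS.1.exists_arc, hiso⟩)
      by_contra hn2
      have : Subsingleton (Fin n) := Fin.subsingleton_iff_le_one.2 (by omega)
      obtain ⟨x⟩ := ‹Nonempty V›
      obtain ⟨y, hne, hxy⟩ := hf.hasMates x
      obtain ⟨e, he⟩ := hiso
      refine hxy ?_
      rw [he, he, cocliqueExt_iff, cocliqueExt_iff]
      refine hsc _ _ fun h1 => hne (e.injective ?_)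
      exact Prod.ext h1.symm (Subsingleton.elim _ _)
    · push Not at hsc
      obtain ⟨s, t, hst, h1, h2⟩ := hsc
      have hR := hS.isReduced hSirr htw hSna ⟨s, t, hst, not_or.2 ⟨h1, h2⟩⟩
      rcases hR.isUniform_or with hX | hX | hX
      · obtain ⟨M, T, hM, hT, hTw, hg, hST⟩ := hX.exists_iso_lexProd
        exact Or.inr (Or.inr (Or.inl ⟨n, hn, M, T, hM, hT, hTw, hg,
          hiso.trans (hST.cocliqueExt n)⟩))
      · exact Or.inl ⟨n, hn, hiso.trans (hX.iso_cay6.cocliqueExt n)⟩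
      · obtain ⟨d, hU⟩ : ∃ d, IsUniform S (tdist S) d := hX.elim (fun e => ⟨_, e⟩) fun e => ⟨_, e⟩
        by_cases hE : ∃ s t, S s t ∧ S t s
        · obtain ⟨k, m, f, hk, hm, hSf, hval, hdr⟩ := hU.exists_doublyRegular
          have hn' : n = 1 := hn1.resolve_right fun hn1 => by
            obtain ⟨s, t, hst⟩ := hR.exists_nonadj
            exact hn1 hE s t hst
          rw [hn'] at hiso
          exact Or.inr (Or.inr (Or.inr (Or.inr ⟨k, m, hk, hm, N, S, f, hSf, hval, hdr,
            hiso.trans (iso_cocliqueExt_one S)⟩)))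
        · push Not at hE
          obtain ⟨k, l, f, α, β, γ, hk, hl, hT, hII, hα, hβ, hγ⟩ :=
            hU.exists_tournament fun s t e => hE s t e.1 e.2
          exact Or.inr (Or.inr (Or.inr (Or.inl ⟨k, l, n, hk, hl, hn, N, S, f, α, β, γ, hT, hII,
            hα, hβ, hγ, hiso⟩)))
  · have harc := h.1.exists_arc
    rintro (⟨n, -, hiso⟩ | ⟨n, hn, N, S, -, hS, -, -, hiso⟩ | ⟨n, -, N, S, -, hS, -, -, hiso⟩ |
      ⟨k, l, n, -, -, -, N, B, f, α, β, γ, hB, -, -, -, -, hiso⟩ |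
      ⟨k, m, -, -, N, B, f, hB, -, -, hiso⟩)
    · exact isSemicompleteMultipartite_of_iso_cocliqueExt hirr harc hiso cay6_nonadjTrans
        (Or.inl cay6_hasMates)
    · exact isSemicompleteMultipartite_of_iso_cocliqueExt hirr harc hiso hS.nonadjTrans
        (Or.inr hn)
    · exact isSemicompleteMultipartite_of_iso_cocliqueExt hirr harc hiso
        (lexProd_nonadjTrans hS c4_nonadjTrans) (Or.inl (lexProd_hasMates hS.1 c4_hasMates))
    · have hB' := hB.1.1.isSemicompleteMultipartiteWith
      exact isSemicompleteMultipartite_of_iso_cocliqueExt hirr harc hiso hB'.nonadjTrans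
        (Or.inl hB'.hasMates)
    · have hB' := hB.isSemicompleteMultipartiteWith
      exact isSemicompleteMultipartite_of_iso_cocliqueExt hirr harc
        (hiso.trans (iso_cocliqueExt_one B).symm) hB'.nonadjTrans (Or.inl hB'.hasMates)

end Paper
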